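/- arXiv:2502.11243 — 2 statements merged into one kernel-verified Lean document; each statement's English description precedes it below -/
import Mathlib

section
/- Let S be a solution concept that permits bracketing and satisfies distribution-monotonicity and anonymity. Then there exists a monotone additive statistic Φ such that either (i) every solution of every game is a Nash_Φ equilibrium (S is a refinement of Nash_Φ), or (ii) there exists λ ≥ 0 such that every solution of every game is an LQRE_{λΦ} equilibrium (S is a refinement of LQRE_{λΦ}). -/
open Filter Topology MeasureTheory

noncomputable section

namespace Paper

/-! ## Lotteries as finitely supported probability mass functions on ℝ -/

open Classical in
/-- The point mass at `a`. -/
def delta {α : Type*} (a : α) : α → ℝ := fun b => if b = a then 1 else 0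

/-- `f` is (the p.m.f. of) a finitely supported lottery. -/
def IsFinLottery (f : ℝ → ℝ) : Prop :=
  (∀ x, 0 ≤ f x) ∧ (Function.support f).Finite ∧ ∑ᶠ x, f x = 1

/-- The CDF of a mass function. -/
def cdfOf (f : ℝ → ℝ) (t : ℝ) : ℝ := ∑ᶠ x, if x ≤ t then f x else 0

/-- Convolution: the distribution of the sum of independent draws. -/
def conv (f g : ℝ → ℝ) : ℝ → ℝ := fun z => ∑ᶠ x, f x * g (z - x)

/-- Expectation of a finitely supported lottery. -/
def expOf (f : ℝ → ℝ) : ℝ := ∑ᶠ x, x * f x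

/-- Weak first-order stochastic dominance of `f` over `g`. -/
def FOSDgeF (f g : ℝ → ℝ) : Prop := ∀ t, cdfOf f t ≤ cdfOf g t

/-- Strict first-order stochastic dominance of `f` over `g`. -/
def FOSDgtF (f g : ℝ → ℝ) : Prop := FOSDgeF f g ∧ f ≠ g

/-- Finitely supported lotteries with rational-valued CDF (`Δ_ℚ`). -/
def IsDeltaQ (f : ℝ → ℝ) : Prop := IsFinLottery f ∧ ∀ t, ∃ q : ℚ, cdfOf f t = (q : ℝ)

/-- Monotone additive statistic on all finitely supported lotteries. -/
def MAS (Φ : (ℝ → ℝ) → ℝ) : Prop :=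
  (∀ c : ℝ, Φ (delta c) = c) ∧
  (∀ f g, IsFinLottery f → IsFinLottery g → Φ (conv f g) = Φ f + Φ g) ∧
  (∀ f g, IsFinLottery f → IsFinLottery g → FOSDgeF f g → Φ g ≤ Φ f)

/-- Monotone additive statistic on `Δ_ℚ`. -/
def MASQ (Φ : (ℝ → ℝ) → ℝ) : Prop :=
  (∀ c : ℝ, Φ (delta c) = c) ∧
  (∀ f g, IsDeltaQ f → IsDeltaQ g → Φ (conv f g) = Φ f + Φ g) ∧
  (∀ f g, IsDeltaQ f → IsDeltaQ g → FOSDgeF f g → Φ g ≤ Φ f)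

/-- The statistic `K_a` for `a` in the extended real line. -/
def Kstat (a : EReal) (f : ℝ → ℝ) : ℝ :=
  if a = ⊤ then sSup (Function.support f)
  else if a = ⊥ then sInf (Function.support f)
  else if a = 0 then expOf f
  else (a.toReal)⁻¹ * Real.log (∑ᶠ x, Real.exp (a.toReal * x) * f x)

/-- `K_a` for real `a`. -/
def Kreal (a : ℝ) : (ℝ → ℝ) → ℝ := Kstat (a : EReal)

/-- The statistic `Φ[X] = ∫ K_a[X] dμ(a)`. -/
def PhiInt (μ : Measure EReal) (f : ℝ → ℝ) : ℝ := ∫ a, Kstat a f ∂μ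

/-! ## Finite normal-form games -/

structure Game (N : ℕ) where
  A : Fin N → Type
  fintypeA : ∀ i, Fintype (A i)
  nonemptyA : ∀ i, Nonempty (A i)
  u : ((i : Fin N) → A i) → Fin N → ℝ

instance {N : ℕ} (G : Game N) (i : Fin N) : Fintype (G.A i) := G.fintypeA i
instance {N : ℕ} (G : Game N) (i : Fin N) : Nonempty (G.A i) := G.nonemptyA i

/-- A (mixed strategy) profile: a real-valued function on each action set. -/
abbrev Profile {N : ℕ} (G : Game N) := (i : Fin N) → G.A i → ℝ

/-- `p` is a mixed strategy profile. -/
def IsMixed {N : ℕ} (G : Game N) (p : Profile G) : Prop :=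
  ∀ i, (∀ ai, 0 ≤ p i ai) ∧ ∑ ai, p i ai = 1

/-- Probability of the full action profile `a` under independent mixing `p`. -/
def weight {N : ℕ} (G : Game N) (p : Profile G) (a : (i : Fin N) → G.A i) : ℝ :=
  ∏ j, p j (a j)

/-- The p.m.f. of player `i`'s payoff lottery `u_i(a_i, p_{-i})`. -/
def payMass {N : ℕ} (G : Game N) (p : Profile G) (i : Fin N) (ai : G.A i) : ℝ → ℝ :=
  fun t => ∑ a : (j : Fin N) → G.A j,
    if G.u a i = t then weight G (Function.update p i (delta ai)) a else 0

/-- Expected payoff `E[u_i(a_i, p_{-i})]`. -/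
def expPay {N : ℕ} (G : Game N) (p : Profile G) (i : Fin N) (ai : G.A i) : ℝ :=
  ∑ a : (j : Fin N) → G.A j, weight G (Function.update p i (delta ai)) a * G.u a i

/-- Expected value of `f` applied to player `i`'s payoff lottery. -/
def expPayOf {N : ℕ} (G : Game N) (p : Profile G) (i : Fin N) (ai : G.A i) (f : ℝ → ℝ) : ℝ :=
  ∑ a : (j : Fin N) → G.A j, weight G (Function.update p i (delta ai)) a * f (G.u a i)

/-- Minimum over `a_{-i}` of `u_i(a_i, a_{-i})`. -/
def minPay {N : ℕ} (G : Game N) (i : Fin N) (ai : G.A i) : ℝ :=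
  ⨅ a : (j : Fin N) → G.A j, G.u (Function.update a i ai) i

/-- Maximum over `a_{-i}` of `u_i(a_i, a_{-i})`. -/
def maxPay {N : ℕ} (G : Game N) (i : Fin N) (ai : G.A i) : ℝ :=
  ⨆ a : (j : Fin N) → G.A j, G.u (Function.update a i ai) i

/-- `a_i` is strictly dominated (by some `b_i`). -/
def StrictlyDominated {N : ℕ} (G : Game N) (i : Fin N) (ai : G.A i) : Prop :=
  ∃ bi : G.A i, ∀ a : (j : Fin N) → G.A j,
    G.u (Function.update a i ai) i < G.u (Function.update a i bi) i

/-! ## Solution concepts and axioms -/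

abbrev SolCon (N : ℕ) := (G : Game N) → Set (Profile G)

/-- A solution concept assigns to each game a nonempty set of mixed strategy profiles. -/
def IsSolutionConcept {N : ℕ} (S : SolCon N) : Prop :=
  ∀ G, (S G).Nonempty ∧ ∀ p ∈ S G, IsMixed G p

/-- The composite game `G ⊗ H`. -/
def Game.comp {N : ℕ} (G H : Game N) : Game N where
  A := fun i => G.A i × H.A i
  fintypeA := fun i => inferInstance
  nonemptyA := fun i => inferInstance
  u := fun c i => G.u (fun j => (c j).1) i + H.u (fun j => (c j).2) i

/-- The product profile `p × q`. -/
def prodProfile {N : ℕ} {G H : Game N} (p : Profile G) (q : Profile H) :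
    Profile (G.comp H) := fun i ab => p i ab.1 * q i ab.2

def Bracketing {N : ℕ} (S : SolCon N) : Prop :=
  ∀ (G H : Game N) (p : Profile G) (q : Profile H),
    p ∈ S G → q ∈ S H → prodProfile p q ∈ S (G.comp H)

/-- The permuted game `G_π`. -/
def Game.permute {N : ℕ} (G : Game N) (π : Equiv.Perm (Fin N)) : Game N where
  A := fun i => G.A (π i)
  fintypeA := fun i => G.fintypeA (π i)
  nonemptyA := fun i => G.nonemptyA (π i)
  u := fun b i =>
    G.u (fun j => cast (congrArg G.A (π.apply_symm_apply j)) (b (π.symm j))) (π i)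

def Anonymity {N : ℕ} (S : SolCon N) : Prop :=
  ∀ (π : Equiv.Perm (Fin N)) (G : Game N) (p : Profile G),
    p ∈ S G → (fun i => p (π i)) ∈ S (G.permute π)

def ExpectationMonotone {N : ℕ} (S : SolCon N) : Prop :=
  ∀ G, ∀ p ∈ S G, ∀ i, ∀ ai bi : G.A i,
    expPay G p i bi < expPay G p i ai → p i bi ≤ p i ai

def ExpectationNeutral {N : ℕ} (S : SolCon N) : Prop :=
  ∀ G, ∀ p ∈ S G, ∀ i, ∀ ai bi : G.A i,
    expPay G p i ai = expPay G p i bi → p i ai = p i bi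

def DistributionMonotone {N : ℕ} (S : SolCon N) : Prop :=
  ∀ G, ∀ p ∈ S G, ∀ i, ∀ ai bi : G.A i,
    FOSDgtF (payMass G p i ai) (payMass G p i bi) → p i bi ≤ p i ai

def Interiority {N : ℕ} (S : SolCon N) : Prop :=
  ∀ G, ∀ p ∈ S G, ∀ i, ∀ ai : G.A i, 0 < p i ai

/-- The game with payoffs rescaled by `α`. -/
def Game.scale {N : ℕ} (G : Game N) (α : ℝ) : Game N :=
  { G with u := fun a i => α * G.u a i }

def ScaleInvariant {N : ℕ} (S : SolCon N) : Prop :=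
  ∀ G : Game N, ∀ p ∈ S G,
    (∀ i, ∀ ai : G.A i, p i ai = ((Fintype.card (G.A i) : ℝ))⁻¹) →
    ∀ α ∈ Set.Ioo (0 : ℝ) 1, p ∈ S (G.scale α)

def StratInvariant {N : ℕ} (S : SolCon N) : Prop :=
  ∀ (G : Game N) (u' : ((i : Fin N) → G.A i) → Fin N → ℝ),
    (∀ i, ∃ w : ((j : Fin N) → G.A j) → ℝ,
      (∀ a, ∀ bi : G.A i, w (Function.update a i bi) = w a) ∧
      (∀ a, u' a i = G.u a i + w a)) →
    S G = S { G with u := u' }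

/-! ## Equilibrium notions -/

def IsNash {N : ℕ} (G : Game N) (p : Profile G) : Prop :=
  ∀ i, ∀ ai : G.A i, 0 < p i ai → ∀ bi : G.A i, expPay G p i bi ≤ expPay G p i ai

def IsLQRE {N : ℕ} (lam : ℝ) (G : Game N) (p : Profile G) : Prop :=
  ∀ i, ∀ ai : G.A i,
    p i ai = Real.exp (lam * expPay G p i ai) / ∑ bi, Real.exp (lam * expPay G p i bi)

def IsNashPhi {N : ℕ} (Φ : (ℝ → ℝ) → ℝ) (G : Game N) (p : Profile G) : Prop :=
  ∀ i, ∀ ai : G.A i, 0 < p i ai → ∀ bi : G.A i,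
    Φ (payMass G p i bi) ≤ Φ (payMass G p i ai)

def IsLQREPhi {N : ℕ} (Φ : (ℝ → ℝ) → ℝ) (lam : ℝ) (G : Game N) (p : Profile G) : Prop :=
  ∀ i, ∀ ai : G.A i,
    p i ai = Real.exp (lam * Φ (payMass G p i ai)) /
      ∑ bi, Real.exp (lam * Φ (payMass G p i bi))

def IsFOSDNash {N : ℕ} (G : Game N) (p : Profile G) : Prop :=
  ∀ i, ∀ ai : G.A i,
    (∃ bi : G.A i, FOSDgtF (payMass G p i bi) (payMass G p i ai)) → p i ai = 0

def IsFOSDQRE {N : ℕ} (G : Game N) (p : Profile G) : Prop :=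
  (∀ i, ∀ ai : G.A i, 0 < p i ai) ∧
  ∀ i, ∀ ai bi : G.A i,
    FOSDgeF (payMass G p i ai) (payMass G p i bi) → p i bi ≤ p i ai

def IsMinMaxMean {N : ℕ} (l1 l2 l3 : ℝ) (G : Game N) (p : Profile G) : Prop :=
  ∀ i, ∀ ai : G.A i,
    p i ai = Real.exp (l1 * minPay G i ai + l2 * expPay G p i ai + l3 * maxPay G i ai) /
      ∑ bi, Real.exp (l1 * minPay G i bi + l2 * expPay G p i bi + l3 * maxPay G i bi)

def CompatibleEU {N : ℕ} (S : SolCon N) : Prop :=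
  ∃ f : ℝ → ℝ, StrictMono f ∧ Continuous f ∧
    ∀ G, ∀ p ∈ S G, ∀ i, ∀ ai bi : G.A i,
      expPayOf G p i bi f < expPayOf G p i ai f → p i bi ≤ p i ai

/-! ## Lotteries as compactly supported probability measures on ℝ -/

/-- Convolution of measures: distribution of the sum of independent draws. -/
def mconv (μ ν : Measure ℝ) : Measure ℝ := (μ.prod ν).map (fun z : ℝ × ℝ => z.1 + z.2)

/-- `npow μ m` is the `m`-fold convolution `μ^m`. -/
def npow (μ : Measure ℝ) : ℕ → Measure ℝ
  | 0 => Measure.dirac 0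
  | n + 1 => mconv (npow μ n) μ

/-- The distribution of `β` times a draw from `μ`. -/
def mscale (β : ℝ) (μ : Measure ℝ) : Measure ℝ := μ.map (fun x => β * x)

/-- `μ` is compactly supported. -/
def CompSupp (μ : Measure ℝ) : Prop := ∃ a b : ℝ, μ (Set.Icc a b)ᶜ = 0

/-- The minimum of the support of `μ`. -/
def minSupp (μ : Measure ℝ) : ℝ := sSup {x : ℝ | μ (Set.Iio x) = 0}

/-- The maximum of the support of `μ`. -/
def maxSupp (μ : Measure ℝ) : ℝ := sInf {x : ℝ | μ (Set.Ioi x) = 0}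

/-- Weak first-order stochastic dominance of `μ` over `ν`. -/
def FOSDgeM (μ ν : Measure ℝ) : Prop := ∀ t, μ (Set.Iic t) ≤ ν (Set.Iic t)

/-- Strict first-order stochastic dominance of `μ` over `ν`. -/
def FOSDgtM (μ ν : Measure ℝ) : Prop := FOSDgeM μ ν ∧ μ ≠ ν

/-- Monotone additive statistic on compactly supported lotteries (as measures). -/
def MASm (Φ : Measure ℝ → ℝ) : Prop :=
  (∀ c : ℝ, Φ (Measure.dirac c) = c) ∧
  (∀ μ ν : Measure ℝ, IsProbabilityMeasure μ → IsProbabilityMeasure ν →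
    CompSupp μ → CompSupp ν → Φ (mconv μ ν) = Φ μ + Φ ν) ∧
  (∀ μ ν : Measure ℝ, IsProbabilityMeasure μ → IsProbabilityMeasure ν →
    CompSupp μ → CompSupp ν → FOSDgeM μ ν → Φ ν ≤ Φ μ)

/-! ## Two-player games, unbundled -/

/-- `p` is a probability distribution on the finite type `α`. -/
def IsDist {α : Type*} [Fintype α] (p : α → ℝ) : Prop :=
  (∀ a, 0 ≤ p a) ∧ ∑ a, p a = 1

/-- Payoff lottery of player 1 playing `a` against the mixed strategy `q`. -/
def mass1 {α β : Type*} [Fintype β] (u : α → β → ℝ) (q : β → ℝ) (a : α) : ℝ → ℝ :=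
  fun t => ∑ b, if u a b = t then q b else 0

/-- Payoff lottery of player 2 playing `b` against the mixed strategy `p`. -/
def mass2 {α β : Type*} [Fintype α] (u : α → β → ℝ) (p : α → ℝ) (b : β) : ℝ → ℝ :=
  fun t => ∑ a, if u a b = t then p a else 0

/-- The distribution of a random variable on the uniform space `{1,…,m}`. -/
def distOf {m : ℕ} (X : Fin m → ℝ) : ℝ → ℝ :=
  fun t => (∑ ω : Fin m, if X ω = t then (1 : ℝ) else 0) / m

/-- A submonoid of `M × M × ℝ` is read as a family of constraints `r ≤ φ X - φ Y` on an additive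
`φ : M → ℝ`. If the constraints are consistent and bound every element, such a `φ` exists. -/
theorem exists_additive_of_consistent {M : Type*} [CommMonoid M]
    (T : Submonoid (M × M × Multiplicative ℝ))
    (hT : ∀ X r, (X, X, r) ∈ T → r.toAdd ≤ 0)
    (hb : ∀ X, ∃ r, (X, 1, r) ∈ T ∧ (1, X, r) ∈ T) :
    ∃ φ : M → ℝ, (∀ X Y, φ (X * Y) = φ X + φ Y) ∧
      ∀ X Y r, (X, Y, r) ∈ T → r.toAdd ≤ φ X - φ Y := by
  obtain ⟨U, hTU, hU⟩ := zorn_le_nonempty₀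
    {U : Submonoid (M × M × Multiplicative ℝ) | ∀ X r, (X, X, r) ∈ U → r.toAdd ≤ 0} (by
      intro c hc hchain V hV
      refine ⟨sSup c, fun X r hX => ?_, fun W hW => le_sSup hW⟩
      obtain ⟨W, hW, hXW⟩ :=
        (Submonoid.mem_sSup_of_directedOn ⟨V, hV⟩ hchain.directedOn).1 hX
      exact hc hW X r hXW) T hT
  have hcons : ∀ X (r : ℝ), (X, X, Multiplicative.ofAdd r) ∈ U → r ≤ 0 :=
    fun X r h => hU.prop X _ h
  have hdich : ∀ X (s : ℝ), (X, 1, Multiplicative.ofAdd s) ∈ U ∨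
      ∃ A n t, (A, A * X ^ n, Multiplicative.ofAdd t) ∈ U ∧ 0 < t + (n : ℕ) * s := by
    intro X s
    by_contra! hne
    refine hne.1 ?_
    have hle : U ≤ U ⊔ Submonoid.closure {(X, 1, Multiplicative.ofAdd s)} := le_sup_left
    refine hU.le_of_ge ?_ hle (Submonoid.mem_sup_right (Submonoid.subset_closure rfl))
    intro C r hC
    obtain ⟨⟨A, B, t⟩, hy, z, hz, hyz⟩ := Submonoid.mem_sup.1 hC
    obtain ⟨n, rfl⟩ := Submonoid.mem_closure_singleton.1 hz
    simp only [Prod.pow_mk, Prod.mk_mul_mk, one_pow, mul_one, Prod.mk.injEq] at hyz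
    obtain ⟨rfl, rfl, rfl⟩ := hyz
    have := hne.2 A n t.toAdd hy
    simpa using this
  have hbdd : ∀ X, BddAbove {s : ℝ | (X, 1, Multiplicative.ofAdd s) ∈ U} := by
    intro X
    obtain ⟨r, -, hr⟩ := hb X
    refine ⟨-r.toAdd, fun s hs => ?_⟩
    have := U.mul_mem hs (hTU hr)
    simp only [Prod.mk_mul_mk, mul_one, one_mul] at this
    have := hU.prop X _ this
    simp only [toAdd_mul, toAdd_ofAdd] at this
    linarith
  have hne : ∀ X, {s : ℝ | (X, 1, Multiplicative.ofAdd s) ∈ U}.Nonempty := by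
    intro X
    obtain ⟨r, hr, -⟩ := hb X
    exact ⟨r.toAdd, hTU hr⟩
  let φ : M → ℝ := fun X => sSup {s : ℝ | (X, 1, Multiplicative.ofAdd s) ∈ U}
  have hlow : ∀ X s, s < φ X → ∃ s', (X, 1, Multiplicative.ofAdd s') ∈ U ∧ s < s' :=
    fun X s h => exists_lt_of_lt_csSup (hne X) h
  have hle : ∀ X (s : ℝ), (X, 1, Multiplicative.ofAdd s) ∈ U → s ≤ φ X :=
    fun X s h => le_csSup (hbdd X) h
  have hup : ∀ X s, φ X < s →
      ∃ A n t, (A, A * X ^ n, Multiplicative.ofAdd t) ∈ U ∧ 0 < t + (n : ℕ) * s :=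
    fun X s h => (hdich X s).resolve_left fun h' => (hle X s h').not_gt h
  refine ⟨φ, fun X Y => le_antisymm ?_ ?_, fun X Y r hr => ?_⟩
  · by_contra! hlt
    obtain ⟨s, hs, hs'⟩ : ∃ s, φ X < s ∧ s < φ (X * Y) - φ Y := exists_between (by linarith)
    obtain ⟨v, hv, hv'⟩ := hlow (X * Y) (s + φ Y) (by linarith)
    obtain ⟨A, n, t, hA, ht⟩ := hup X s hs
    obtain ⟨A', n', t', hA', ht'⟩ := hup Y (v - s) (by linarith)
    have key := U.mul_mem (U.mul_mem (U.pow_mem hA n') (U.pow_mem hA' n)) (U.pow_mem hv (n * n'))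
    simp only [Prod.pow_mk, Prod.mk_mul_mk, one_pow, mul_one] at key
    have e : (A * X ^ n) ^ n' * (A' * Y ^ n') ^ n = A ^ n' * A' ^ n * (X * Y) ^ (n * n') := by
      simp only [mul_pow, ← pow_mul, mul_comm n' n, mul_assoc, mul_left_comm]
    rw [e] at key
    have := hU.prop _ _ key
    simp only [toAdd_mul, toAdd_pow, toAdd_ofAdd, nsmul_eq_mul, Nat.cast_mul] at this
    rcases Nat.eq_zero_or_pos n with rfl | hn
    · have := hcons A t (by simpa using hA)
      simp at ht
      linarith
    · have h1 : (0 : ℝ) < n := by exact_mod_cast hn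
      have h2 : (0 : ℝ) ≤ n' := by positivity
      nlinarith [mul_nonneg h2 ht.le, mul_pos h1 ht']
  · by_contra! hlt
    obtain ⟨s, hs, hs'⟩ := hlow X (φ (X * Y) - φ Y) (by linarith)
    obtain ⟨v, hv, hv'⟩ := hlow Y (φ (X * Y) - s) (by linarith)
    have := U.mul_mem hs hv
    simp only [Prod.mk_mul_mk, mul_one, ← ofAdd_add] at this
    have := hle _ _ this
    linarith
  · by_contra! hlt
    obtain ⟨s, hs, hs'⟩ : ∃ s, φ X < s ∧ s < φ Y + r.toAdd := exists_between (by linarith)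
    obtain ⟨v, hv, hv'⟩ := hlow Y (s - r.toAdd) (by linarith)
    obtain ⟨A, n, t, hA, ht⟩ := hup X s hs
    have key := U.mul_mem hA (U.pow_mem (U.mul_mem (hTU hr) hv) n)
    simp only [Prod.pow_mk, Prod.mk_mul_mk, mul_one] at key
    rw [mul_assoc, ← mul_pow] at key
    have := hU.prop _ _ key
    simp only [toAdd_mul, toAdd_pow, toAdd_ofAdd, nsmul_eq_mul] at this
    have h2 : (0 : ℝ) ≤ n := by positivity
    nlinarith

/-! ## The monoid of lotteries -/

/-- The integral of `h` against an element of the convolution algebra `ℝ[ℝ]`. -/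
def pairing (h : ℝ → ℝ) (f : AddMonoidAlgebra ℝ ℝ) : ℝ := f.coeff.sum fun x w => w * h x

lemma pairing_add (h : ℝ → ℝ) (f g : AddMonoidAlgebra ℝ ℝ) :
    pairing h (f + g) = pairing h f + pairing h g := by
  simp only [pairing, AddMonoidAlgebra.coeff_add]
  exact Finsupp.sum_add_index' (by simp) (by intros; ring)

lemma pairing_zero (h : ℝ → ℝ) : pairing h 0 = 0 := by simp [pairing]

lemma pairing_single (h : ℝ → ℝ) (x w : ℝ) :
    pairing h (AddMonoidAlgebra.single x w) = w * h x := by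
  simp [pairing]

lemma pairing_mul_single (h : ℝ → ℝ) (f : AddMonoidAlgebra ℝ ℝ) (z w : ℝ) :
    pairing h (f * AddMonoidAlgebra.single z w) = w * pairing (fun x => h (x + z)) f := by
  induction f using AddMonoidAlgebra.induction_linear with
  | zero => simp [pairing_zero]
  | add f g hf hg => rw [add_mul, pairing_add, hf, hg, pairing_add]; ring
  | single x v => rw [AddMonoidAlgebra.single_mul_single, pairing_single, pairing_single]; ring

lemma pairing_mul (h : ℝ → ℝ) (f g : AddMonoidAlgebra ℝ ℝ) :
    pairing h (f * g) = pairing (fun z => pairing (fun x => h (x + z)) f) g := by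
  induction g using AddMonoidAlgebra.induction_linear with
  | zero => simp [pairing_zero]
  | add g k hg hk => rw [mul_add, pairing_add, hg, hk, pairing_add]
  | single z w => rw [pairing_mul_single, pairing_single]

lemma pairing_mono {h k : ℝ → ℝ} {f : AddMonoidAlgebra ℝ ℝ} (hf : ∀ x, 0 ≤ f.coeff x)
    (hhk : ∀ x ∈ f.coeff.support, h x ≤ k x) : pairing h f ≤ pairing k f :=
  Finset.sum_le_sum fun x hx => mul_le_mul_of_nonneg_left (hhk x hx) (hf x)

lemma pairing_const (c : ℝ) (f : AddMonoidAlgebra ℝ ℝ) :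
    pairing (fun _ => c) f = c * pairing (fun _ => 1) f := by
  simp [pairing, Finsupp.sum, Finset.mul_sum, mul_comm]

/-- Finitely supported lotteries, with convolution as product. -/
def lotteries : Submonoid (AddMonoidAlgebra ℝ ℝ) where
  carrier := {f | (∀ x, 0 ≤ f.coeff x) ∧ pairing (fun _ => 1) f = 1}
  one_mem' := by
    refine ⟨fun x => ?_, by rw [AddMonoidAlgebra.one_def, pairing_single, one_mul]⟩
    rw [AddMonoidAlgebra.one_def, AddMonoidAlgebra.coeff_single]
    exact Finsupp.single_nonneg.2 zero_le_one x
  mul_mem' := by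
    rintro f g ⟨hf, hf1⟩ ⟨hg, hg1⟩
    refine ⟨fun x => ?_, by simp only [pairing_mul, hf1, hg1]⟩
    classical
    rw [AddMonoidAlgebra.coeff_mul]
    refine Finset.sum_nonneg fun a _ => Finset.sum_nonneg fun b _ => ?_
    dsimp only
    split_ifs
    exacts [mul_nonneg (hf a) (hg b), le_rfl]

open Classical in
/-- The cumulative distribution function of an element of `ℝ[ℝ]`. -/
def cdf (f : AddMonoidAlgebra ℝ ℝ) (t : ℝ) : ℝ := pairing (fun x => if x ≤ t then 1 else 0) f

lemma cdf_mul (f g : AddMonoidAlgebra ℝ ℝ) (t : ℝ) :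
    cdf (f * g) t = pairing (fun z => cdf f (t - z)) g := by
  simp only [cdf, pairing_mul, le_sub_iff_add_le]

/-- First-order stochastic dominance on the monoid of lotteries. -/
def Dominates (X Y : lotteries) : Prop := ∀ t, cdf X.1 t ≤ cdf Y.1 t

lemma Dominates.refl (X : lotteries) : Dominates X X := fun _ => le_rfl

lemma Dominates.trans {X Y Z : lotteries} (h : Dominates X Y) (h' : Dominates Y Z) :
    Dominates X Z := fun t => (h t).trans (h' t)

lemma Dominates.mul_right {X Y : lotteries} (h : Dominates X Y) (Z : lotteries) :
    Dominates (X * Z) (Y * Z) := fun t => by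
  simp only [Submonoid.coe_mul, cdf_mul]
  exact pairing_mono Z.2.1 fun z _ => h (t - z)

lemma Dominates.mul {X Y X' Y' : lotteries} (h : Dominates X Y) (h' : Dominates X' Y') :
    Dominates (X * X') (Y * Y') := by
  refine (h.mul_right X').trans ?_
  rw [mul_comm Y, mul_comm Y]
  exact h'.mul_right Y

/-- The lottery paying `c` for sure. -/
def sure (c : ℝ) : lotteries :=
  ⟨AddMonoidAlgebra.single c 1,
    fun x => by
      rw [AddMonoidAlgebra.coeff_single]; exact Finsupp.single_nonneg.2 zero_le_one x,
    by rw [pairing_single, one_mul]⟩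

lemma sure_zero : sure 0 = 1 := rfl

lemma sure_add (c d : ℝ) : sure (c + d) = sure c * sure d := by
  ext1
  simp [sure, AddMonoidAlgebra.single_mul_single]

lemma sure_pow (c : ℝ) (n : ℕ) : sure c ^ n = sure (n * c) := by
  induction n with
  | zero => simp [sure_zero]
  | succ n ih => rw [pow_succ, ih, ← sure_add]; push_cast; ring_nf

lemma cdf_sure (c t : ℝ) : cdf (sure c).1 t = if c ≤ t then 1 else 0 := by
  simp only [cdf, sure, pairing_single, one_mul]

lemma dominates_sure_iff {c d : ℝ} : Dominates (sure c) (sure d) ↔ d ≤ c := by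
  constructor
  · intro h
    have := h c
    simp only [cdf_sure, le_refl, if_true] at this
    by_contra hlt
    rw [if_neg hlt] at this
    linarith
  · intro h t
    simp only [cdf_sure]
    split_ifs <;> linarith

lemma exists_sure_bounds (X : lotteries) :
    ∃ B : ℝ, Dominates (sure B) X ∧ Dominates X (sure (-B)) := by
  have hB : ∀ x ∈ X.1.coeff.support, |x| ≤ ∑ y ∈ X.1.coeff.support, |y| := fun x hx =>
    Finset.single_le_sum (f := fun y : ℝ => |y|) (fun _ _ => abs_nonneg _) hx
  have hX := X.2.2
  refine ⟨∑ y ∈ X.1.coeff.support, |y|, fun t => ?_, fun t => ?_⟩ <;> rw [cdf_sure]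
  · split_ifs with h
    · rw [← hX]
      refine pairing_mono X.2.1 fun x hx => ?_
      rw [if_pos (((le_abs_self x).trans (hB x hx)).trans h)]
    · rw [← zero_mul (pairing (fun _ => 1) X.1), ← pairing_const]
      exact pairing_mono X.2.1 fun x _ => by split_ifs <;> norm_num
  · split_ifs with h
    · rw [← hX]
      exact pairing_mono X.2.1 fun x _ => by split_ifs <;> norm_num
    · rw [← zero_mul (pairing (fun _ => 1) X.1), ← pairing_const]
      refine pairing_mono X.2.1 fun x hx => ?_
      rw [if_neg]
      linarith [neg_abs_le x, hB x hx]

lemma Dominates.ne_of_pos {X Y : lotteries} {c : ℝ} (hc : 0 < c)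
    (h : Dominates X (Y * sure c)) : X ≠ Y := by
  rintro rfl
  have hn : ∀ n : ℕ, Dominates X (X * sure (n * c)) := by
    intro n
    induction n with
    | zero => simpa [sure_zero] using Dominates.refl X
    | succ n ih =>
      refine ih.trans ((h.mul_right _).trans ?_)
      rw [mul_assoc, ← sure_add]
      convert Dominates.refl _ using 3
      push_cast; ring
  obtain ⟨B, h1, h2⟩ := exists_sure_bounds X
  obtain ⟨n, hn'⟩ := exists_nat_gt (2 * B / c)
  rw [div_lt_iff₀ hc] at hn'
  have := (h1.trans (hn n)).trans (h2.mul_right _)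
  rw [← sure_add, dominates_sure_iff] at this
  linarith

lemma dominates_of_sure_le {X Y : lotteries} {c : ℝ} (hc : 0 ≤ c)
    (h : Dominates X (Y * sure c)) : Dominates X Y := by
  refine h.trans ?_
  have := (Dominates.refl Y).mul (dominates_sure_iff.2 hc)
  rwa [sure_zero, mul_one] at this

/-- Cancelling a bounded factor from a dominance relation, at the cost of a constant. -/
lemma exists_dominates_pow {X Y Z : lotteries} (h : Dominates (Z * X) (Z * Y)) :
    ∃ B : ℝ, ∀ n : ℕ, Dominates (X ^ n * sure B) (Y ^ n) := by
  have hn : ∀ n : ℕ, Dominates (Z * X ^ n) (Z * Y ^ n) := by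
    intro n
    induction n with
    | zero => simpa using Dominates.refl Z
    | succ n ih =>
      have h1 := ih.mul_right X
      have h2 := h.mul_right (Y ^ n)
      rw [pow_succ, pow_succ, ← mul_assoc, ← mul_assoc]
      refine h1.trans ?_
      rwa [mul_right_comm, mul_right_comm Z _ Y]
  obtain ⟨B, h1, h2⟩ := exists_sure_bounds Z
  refine ⟨B + B, fun n => ?_⟩
  have h3 := (h1.mul_right (X ^ n)).trans ((hn n).trans (h2.mul_right (Y ^ n)))
  have h4 := h3.mul_right (sure B)
  have e1 : sure B * X ^ n * sure B = X ^ n * sure (B + B) := by rw [sure_add]; ac_rfl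
  have e2 : sure (-B) * Y ^ n * sure B = Y ^ n := by
    rw [mul_right_comm, ← sure_add, neg_add_cancel, sure_zero, one_mul]
  rwa [e1, e2] at h4

/-- The constraints that follow from `P` and from a relation `D` compatible with products. -/
def constraintsUpTo {M A : Type*} [CommMonoid M] [CommMonoid A] (D : M → M → Prop) (h1 : D 1 1)
    (hD : ∀ {X Y X' Y'}, D X Y → D X' Y' → D (X * X') (Y * Y'))
    (P : Submonoid (M × M × A)) : Submonoid (M × M × A) where
  carrier := {q | ∃ X Y, (X, Y, q.2.2) ∈ P ∧ D (q.1 * Y) (q.2.1 * X)}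
  one_mem' := ⟨1, 1, P.one_mem, by simpa using h1⟩
  mul_mem' := by
    rintro ⟨A, B, r⟩ ⟨A', B', r'⟩ ⟨X, Y, h, hd⟩ ⟨X', Y', h', hd'⟩
    refine ⟨X * X', Y * Y', P.mul_mem h h', ?_⟩
    have := hD hd hd'
    rwa [mul_mul_mul_comm, mul_mul_mul_comm B] at this

/-- A family `P` of constraints `r ≤ φ X - φ Y` on a monotone additive `φ` which never contradicts
dominance between large powers is satisfied by some `φ`. -/
theorem exists_monotone_additive (P : Submonoid (lotteries × lotteries × Multiplicative ℝ))
    (hP : ∀ X Y r B, (X, Y, r) ∈ P → (∀ n : ℕ, Dominates (Y ^ n * sure B) (X ^ n)) → r.toAdd ≤ 0)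
    (hsure : ∀ c, ∃ r, (1, sure c, r) ∈ P) :
    ∃ φ : lotteries → ℝ, (∀ X Y, φ (X * Y) = φ X + φ Y) ∧
      (∀ X Y, Dominates X Y → φ Y ≤ φ X) ∧
      ∀ X Y r, (X, Y, r) ∈ P → r.toAdd ≤ φ X - φ Y := by
  let T := constraintsUpTo Dominates (Dominates.refl 1) (fun h h' => h.mul h') P
  obtain ⟨φ, hadd, hφ⟩ := exists_additive_of_consistent T
    (by
      rintro Z r ⟨X, Y, h, hd⟩
      obtain ⟨B, hB⟩ := exists_dominates_pow hd
      exact hP X Y r B h hB)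
    (by
      intro Z
      obtain ⟨B, h1, h2⟩ := exists_sure_bounds Z
      obtain ⟨r, hr⟩ := hsure B
      refine ⟨r, ⟨1, sure B, hr, ?_⟩, ⟨1, sure B, hr, by simpa using h1⟩⟩
      have := h2.mul_right (sure B)
      rw [← sure_add, neg_add_cancel, sure_zero] at this
      simpa using this)
  refine ⟨φ, hadd, fun X Y h => ?_, fun X Y r h => hφ X Y r ⟨X, Y, h, ?_⟩⟩
  · have := hφ X Y 1 ⟨1, 1, P.one_mem, by simpa using h⟩
    simp only [toAdd_one] at this
    linarith
  · dsimp only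
    rw [mul_comm]
    exact Dominates.refl _

/-- The constraints `a - b ≤ φ (X * s a) - φ (Y * s b)` for `(X, Y) ∈ Q`. -/
def shiftedConstraints {M : Type*} [CommMonoid M] (s : ℝ → M) (h0 : s 0 = 1)
    (hs : ∀ a b, s (a + b) = s a * s b) (Q : Submonoid (M × M)) :
    Submonoid (M × M × Multiplicative ℝ) where
  carrier := {q | ∃ X Y a b, (X, Y) ∈ Q ∧ q = (X * s a, Y * s b, Multiplicative.ofAdd (a - b))}
  one_mem' := ⟨1, 1, 0, 0, Q.one_mem, by simp [Prod.ext_iff, h0]⟩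
  mul_mem' := by
    rintro _ _ ⟨X, Y, a, b, h, rfl⟩ ⟨X', Y', a', b', h', rfl⟩
    refine ⟨X * X', Y * Y', a + a', b + b', Q.mul_mem h h', ?_⟩
    rw [Prod.mk_mul_mk, Prod.mk_mul_mk, hs, hs, mul_mul_mul_comm, mul_mul_mul_comm Y,
      ← ofAdd_add, add_sub_add_comm]

/-- A normalized monotone additive statistic that weakly prefers `X` to `Y` for all `(X, Y) ∈ Q`
exists unless sufficiently large powers of some `(X, Y) ∈ Q` contradict it. -/
theorem exists_statistic (Q : Submonoid (lotteries × lotteries))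
    (hQ : ∀ X Y c B, (X, Y) ∈ Q →
      (∀ n : ℕ, Dominates (Y ^ n * sure B) (X ^ n * sure (n * c))) → c ≤ 0) :
    ∃ φ : lotteries → ℝ, (∀ X Y, φ (X * Y) = φ X + φ Y) ∧
      (∀ X Y, Dominates X Y → φ Y ≤ φ X) ∧ (∀ c, φ (sure c) = c) ∧
      ∀ X Y, (X, Y) ∈ Q → φ Y ≤ φ X := by
  let P := shiftedConstraints sure sure_zero sure_add Q
  have hone : ∀ a b, (sure a, sure b, Multiplicative.ofAdd (a - b)) ∈ P := fun a b =>
    ⟨1, 1, a, b, Q.one_mem, by rw [one_mul, one_mul]⟩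
  obtain ⟨φ, hadd, hmono, hφ⟩ := exists_monotone_additive P
    (by
      rintro _ _ _ B ⟨X, Y, a, b, h, he⟩ hn
      simp only [Prod.mk.injEq] at he
      obtain ⟨rfl, rfl, rfl⟩ := he
      refine hQ X Y (a - b) B h fun n => ?_
      have := (hn n).mul_right (sure (n * -b))
      rw [mul_pow, mul_pow, sure_pow, sure_pow] at this
      have e1 : Y ^ n * sure (n * b) * sure B * sure (n * -b) = Y ^ n * sure B := by
        rw [mul_right_comm, mul_assoc (Y ^ n), ← sure_add, mul_neg, add_neg_cancel, sure_zero,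
          mul_one]
      have e2 : X ^ n * sure (n * a) * sure (n * -b) = X ^ n * sure (n * (a - b)) := by
        rw [mul_assoc, ← sure_add, ← mul_add, sub_eq_add_neg]
      rwa [e1, e2] at this)
    (fun c => ⟨_, hone 0 c⟩)
  have hφ1 : φ 1 = 0 := by simpa using hadd 1 1
  refine ⟨φ, hadd, hmono, fun c => ?_, fun X Y h => ?_⟩
  · have h1 := hφ _ _ _ (hone c 0)
    have h2 := hφ _ _ _ (hone 0 c)
    simp only [sure_zero, hφ1, toAdd_ofAdd] at h1 h2
    linarith
  · have := hφ X Y (Multiplicative.ofAdd (0 - 0)) ⟨X, Y, 0, 0, h, by simp [sure_zero]⟩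
    simp only [toAdd_ofAdd] at this
    linarith

lemma monotone_additive_sure {φ : lotteries → ℝ} (hadd : ∀ X Y, φ (X * Y) = φ X + φ Y)
    (hmono : ∀ X Y, Dominates X Y → φ Y ≤ φ X) (c : ℝ) : φ (sure c) = c * φ (sure 1) := by
  let f : ℝ →+ ℝ := AddMonoidHom.mk' (fun c => φ (sure c)) fun a b => by rw [sure_add, hadd]
  have hf : Monotone f := fun a b h => hmono _ _ (dominates_sure_iff.2 h)
  have := map_real_smul f
    (MeasureTheory.Measure.AddMonoidHom.continuous_of_measurable f hf.measurable) c 1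
  simpa [f] using this

/-- Pairs of lotteries `X, Y` together with weights `x, y` behaving like the payoff lotteries and
the probabilities of two actions of a player in the solutions of games. -/
structure IsChoiceData (D : lotteries → lotteries → ℝ → ℝ → Prop) : Prop where
  nonneg : ∀ {X Y x y}, D X Y x y → 0 ≤ x
  swap : ∀ {X Y x y}, D X Y x y → D Y X y x
  mul : ∀ {X Y x y X' Y' x' y'}, D X Y x y → D X' Y' x' y' →
    D (X * X') (Y * Y') (x * x') (y * y')
  mono : ∀ {X Y x y}, D X Y x y → Dominates X Y → X ≠ Y → y ≤ x
  exists_pos : ∀ {X Y x y}, D X Y x y → ∃ Z z, 0 < z ∧ D Z X z x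
  sure : ∀ c, ∃ x y, x + y = 1 ∧ D (sure c) 1 x y

section ChoiceData

variable {D : lotteries → lotteries → ℝ → ℝ → Prop}

lemma IsChoiceData.exists_one (hD : IsChoiceData D) : ∃ x y, 0 < x ∧ D 1 1 x y := by
  obtain ⟨x, y, hxy, h⟩ := hD.sure 0
  rw [sure_zero] at h
  rcases (hD.nonneg h).eq_or_lt with rfl | hx
  · exact ⟨y, 0, by linarith, hD.swap h⟩
  · exact ⟨x, y, hx, h⟩

lemma IsChoiceData.mono_of_pos (hD : IsChoiceData D) {X Y x y c} (h : D X Y x y) (hc : 0 < c)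
    (hXY : Dominates X (Y * Paper.sure c)) : y ≤ x :=
  hD.mono h (dominates_of_sure_le hc.le hXY) (Dominates.ne_of_pos hc hXY)

/-- If some option is never chosen, choices maximize a monotone additive statistic. -/
theorem IsChoiceData.exists_maximizing (hD : IsChoiceData D)
    (hz : ∃ X Y x, 0 < x ∧ D X Y x 0) :
    ∃ φ : lotteries → ℝ, (∀ X Y, φ (X * Y) = φ X + φ Y) ∧
      (∀ X Y, Dominates X Y → φ Y ≤ φ X) ∧ (∀ c, φ (Paper.sure c) = c) ∧
      ∀ X Y x y, D X Y x y → 0 < x → φ Y ≤ φ X := by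
  let Q : Submonoid (lotteries × lotteries) :=
    { carrier := {q | ∃ x y, 0 < x ∧ D q.1 q.2 x y}
      one_mem' := hD.exists_one
      mul_mem' := by
        rintro q q' ⟨x, y, hx, h⟩ ⟨x', y', hx', h'⟩
        exact ⟨x * x', y * y', mul_pos hx hx', hD.mul h h'⟩ }
  obtain ⟨φ, hadd, hmono, hsure, hφ⟩ := exists_statistic Q (by
    intro X Y c B hXY hn
    by_contra! hc
    obtain ⟨X₀, Y₀, x₀, hx₀, h₀⟩ := hz
    obtain ⟨b, hb, -⟩ := exists_sure_bounds X₀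
    obtain ⟨b', -, hb'⟩ := exists_sure_bounds Y₀
    obtain ⟨n, hnc⟩ := exists_nat_gt ((B + b + b') / c)
    rw [div_lt_iff₀ hc] at hnc
    obtain ⟨x, y, hx, hxy⟩ : ((X, Y) : lotteries × lotteries) ^ n ∈ Q := Q.pow_mem hXY n
    have hdata := hD.swap (hD.mul hxy h₀)
    rw [mul_zero] at hdata
    refine (hD.mono_of_pos hdata (sub_pos.2 hnc) ?_).not_gt (mul_pos hx hx₀)
    have h1 := ((hn n).mul (hb'.mul hb)).mul_right (Paper.sure (-B - b))
    have e1 : Y ^ n * Paper.sure B * (Y₀ * Paper.sure b) * Paper.sure (-B - b) = Y ^ n * Y₀ := by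
      rw [mul_mul_mul_comm, ← sure_add, mul_assoc, ← sure_add]
      simp [sure_zero]
    have e2 : X ^ n * Paper.sure (n * c) * (Paper.sure (-b') * X₀) * Paper.sure (-B - b) =
        X ^ n * X₀ * Paper.sure (n * c - (B + b + b')) := by
      rw [mul_comm (Paper.sure (-b')), mul_mul_mul_comm, ← sure_add, mul_assoc, ← sure_add]
      ring_nf
    rwa [e1, e2] at h1)
  exact ⟨φ, hadd, hmono, hsure, fun X Y x y h hx => hφ X Y ⟨x, y, hx, h⟩⟩

/-- If every option is chosen, log-odds are differences of a monotone additive functional. -/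
theorem IsChoiceData.exists_logit (hD : IsChoiceData D)
    (hpos : ∀ X Y x y, D X Y x y → 0 < x) :
    ∃ φ : lotteries → ℝ, (∀ X Y, φ (X * Y) = φ X + φ Y) ∧
      (∀ X Y, Dominates X Y → φ Y ≤ φ X) ∧
      ∀ X Y x y, D X Y x y → Real.log x - Real.log y = φ X - φ Y := by
  have hpos' : ∀ {X Y x y}, D X Y x y → 0 < y := fun h => hpos _ _ _ _ (hD.swap h)
  let P : Submonoid (lotteries × lotteries × Multiplicative ℝ) :=
    { carrier := {q | ∃ x y, D q.1 q.2.1 x y ∧ q.2.2.toAdd = Real.log x - Real.log y}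
      one_mem' := by
        obtain ⟨x, y, hx, h⟩ := hD.exists_one
        have h1 := hD.mul h (hD.swap h)
        rw [mul_one, mul_comm y] at h1
        exact ⟨x * y, x * y, h1, (sub_self _).symm⟩
      mul_mem' := by
        rintro q q' ⟨x, y, h, hr⟩ ⟨x', y', h', hr'⟩
        refine ⟨x * x', y * y', hD.mul h h', ?_⟩
        rw [Prod.snd_mul, Prod.snd_mul, toAdd_mul, hr, hr',
          Real.log_mul (hpos _ _ _ _ h).ne' (hpos _ _ _ _ h').ne',
          Real.log_mul (hpos' h).ne' (hpos' h').ne']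
        ring }
  have hP : ∀ {X Y x y}, D X Y x y →
      (X, Y, Multiplicative.ofAdd (Real.log x - Real.log y)) ∈ P :=
    fun {X Y x y} h => ⟨x, y, h, rfl⟩
  obtain ⟨φ, hadd, hmono, hφ⟩ := exists_monotone_additive P
    (by
      intro X Y r B hXY hn
      obtain ⟨x', y', -, h'⟩ := hD.sure (B + 1)
      have hbound : ∀ n : ℕ, n * r.toAdd ≤ Real.log x' - Real.log y' := by
        intro n
        obtain ⟨x, y, h, hr⟩ : ((X, Y, r) : lotteries × lotteries × Multiplicative ℝ) ^ n ∈ P :=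
          P.pow_mem hXY n
        have hle := hD.mono_of_pos (hD.mul (hD.swap h) h') one_pos (by
          have := (hn n).mul_right (Paper.sure 1)
          rw [mul_assoc, ← sure_add] at this
          simpa using this)
        have hlog := Real.log_le_log (mul_pos (hpos _ _ _ _ h) (hpos' h')) hle
        rw [Real.log_mul (hpos _ _ _ _ h).ne' (hpos' h').ne',
          Real.log_mul (hpos' h).ne' (hpos _ _ _ _ h').ne'] at hlog
        simp only [Prod.pow_mk, toAdd_pow, nsmul_eq_mul] at hr
        linarith
      by_contra! hr
      obtain ⟨n, hn'⟩ := exists_nat_gt ((Real.log x' - Real.log y') / r.toAdd)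
      rw [div_lt_iff₀ hr] at hn'
      exact (hbound n).not_gt hn')
    (fun c => by
      obtain ⟨x, y, -, h⟩ := hD.sure c
      exact ⟨_, hP (hD.swap h)⟩)
  refine ⟨φ, hadd, hmono, fun X Y x y h => ?_⟩
  have h1 := hφ _ _ _ (hP h)
  have h2 := hφ _ _ _ (hP (hD.swap h))
  simp only [toAdd_ofAdd] at h1 h2
  linarith

/-- Choice data either maximize a monotone additive statistic or are logit with respect to one. -/
theorem IsChoiceData.dichotomy (hD : IsChoiceData D) :
    ∃ φ : lotteries → ℝ, (∀ X Y, φ (X * Y) = φ X + φ Y) ∧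
      (∀ X Y, Dominates X Y → φ Y ≤ φ X) ∧ (∀ c, φ (Paper.sure c) = c) ∧
      ((∀ X Y x y, D X Y x y → 0 < x → φ Y ≤ φ X) ∨
        ∃ lam : ℝ, 0 ≤ lam ∧ ∀ X Y x y, D X Y x y →
          0 < x ∧ Real.log x - Real.log y = lam * φ X - lam * φ Y) := by
  by_cases hz : ∃ X Y x, 0 < x ∧ D X Y x 0
  · obtain ⟨φ, hadd, hmono, hsure, h⟩ := hD.exists_maximizing hz
    exact ⟨φ, hadd, hmono, hsure, Or.inl h⟩
  have hpos : ∀ X Y x y, D X Y x y → 0 < x := by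
    intro X Y x y h
    refine (hD.nonneg h).lt_of_ne fun hx => hz ?_
    obtain ⟨Z, z, hz, hZ⟩ := hD.exists_pos h
    exact ⟨Z, X, z, hz, hx ▸ hZ⟩
  obtain ⟨ψ, hadd, hmono, hψ⟩ := hD.exists_logit hpos
  have hsure := monotone_additive_sure hadd hmono
  have hlam : 0 ≤ ψ (Paper.sure 1) := by
    have := hmono _ _ (dominates_sure_iff.2 (zero_le_one (α := ℝ)))
    rwa [hsure 0, zero_mul] at this
  rcases hlam.eq_or_lt with h0 | hlam'
  · obtain ⟨φ, hadd', hmono', hsure', -⟩ := exists_statistic ⊥ (by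
      intro X Y c B hXY hn
      obtain ⟨rfl, rfl⟩ := Prod.mk_eq_one.1 (Submonoid.mem_bot.1 hXY)
      by_contra! hc
      obtain ⟨n, hn'⟩ := exists_nat_gt (B / c)
      have := hn n
      rw [one_pow, one_mul, one_mul, dominates_sure_iff] at this
      rw [div_lt_iff₀ hc] at hn'
      linarith)
    refine ⟨φ, hadd', hmono', hsure', Or.inr ⟨0, le_rfl, fun X Y x y h =>
      ⟨hpos _ _ _ _ h, ?_⟩⟩⟩
    have hzero : ∀ X, ψ X = 0 := by
      intro X
      obtain ⟨B, h1, h2⟩ := exists_sure_bounds X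
      have h1 := hmono _ _ h1
      have h2 := hmono _ _ h2
      rw [hsure, ← h0, mul_zero] at h1 h2
      exact le_antisymm h1 h2
    rw [hψ _ _ _ _ h, hzero, hzero]
    ring
  · refine ⟨fun X => ψ X / ψ (Paper.sure 1), fun X Y => ?_, fun X Y h => ?_,
      fun c => ?_, Or.inr ⟨ψ (Paper.sure 1), hlam, fun X Y x y h => ⟨hpos _ _ _ _ h, ?_⟩⟩⟩
    · simp only [hadd, add_div]
    · exact div_le_div_of_nonneg_right (hmono _ _ h) hlam
    · simp only [hsure c]
      rw [mul_div_assoc, div_self hlam'.ne', mul_one]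
    · rw [hψ _ _ _ _ h, mul_div_cancel₀ _ hlam'.ne', mul_div_cancel₀ _ hlam'.ne']

end ChoiceData

/-! ## Payoff lotteries of games -/

variable {N : ℕ}

/-- The payoff lottery `u_i(a_i, p_{-i})` as an element of the convolution algebra. -/
def payLottery (G : Game N) (p : Profile G) (i : Fin N) (ai : G.A i) : AddMonoidAlgebra ℝ ℝ :=
  ∑ a : (j : Fin N) → G.A j,
    AddMonoidAlgebra.single (G.u a i) (weight G (Function.update p i (delta ai)) a)

lemma coeff_payLottery (G : Game N) (p : Profile G) (i : Fin N) (ai : G.A i) :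
    ⇑(payLottery G p i ai).coeff = payMass G p i ai := by
  ext t
  simp [payLottery, payMass, Finsupp.single_apply]

lemma sum_delta {α : Type*} [Fintype α] (a : α) : ∑ b, delta a b = 1 := by
  classical
  rw [Finset.sum_eq_single a]
  · exact if_pos rfl
  · exact fun b _ hb => if_neg hb
  · simp

lemma delta_prod {α β : Type*} (a : α) (b : β) (c : α × β) :
    delta (a, b) c = delta a c.1 * delta b c.2 := by
  by_cases h1 : c.1 = a <;> by_cases h2 : c.2 = b <;> simp [delta, Prod.ext_iff, h1, h2]

lemma isMixed_update_delta {G : Game N} {p : Profile G} (hp : IsMixed G p) (i : Fin N)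
    (ai : G.A i) : IsMixed G (Function.update p i (delta ai)) := by
  intro j
  rcases eq_or_ne j i with rfl | hj
  · rw [Function.update_self]
    exact ⟨fun b => by unfold delta; split_ifs <;> norm_num, sum_delta ai⟩
  · rw [Function.update_of_ne hj]
    exact hp j

lemma sum_weight {G : Game N} {p : Profile G} (hp : IsMixed G p) : ∑ a, weight G p a = 1 := by
  simp only [weight]
  rw [← Fintype.prod_sum]
  exact Finset.prod_eq_one fun j _ => (hp j).2

lemma pairing_sum {ι : Type*} (h : ℝ → ℝ) (s : Finset ι) (f : ι → AddMonoidAlgebra ℝ ℝ) :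
    pairing h (∑ i ∈ s, f i) = ∑ i ∈ s, pairing h (f i) :=
  map_sum (AddMonoidHom.mk' (pairing h) (pairing_add h)) f s

lemma payLottery_mem {G : Game N} {p : Profile G} (hp : IsMixed G p) (i : Fin N) (ai : G.A i) :
    payLottery G p i ai ∈ lotteries := by
  have hq := isMixed_update_delta hp i ai
  refine ⟨fun x => ?_, ?_⟩
  · rw [coeff_payLottery]
    refine Finset.sum_nonneg fun a _ => ?_
    split_ifs
    exacts [Finset.prod_nonneg fun j _ => (hq j).1 _, le_rfl]
  · simp only [payLottery, pairing_sum, pairing_single, mul_one, sum_weight hq]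

lemma weight_comp {G H : Game N} (p : Profile G) (q : Profile H) (i : Fin N) (ai : G.A i)
    (bi : H.A i) (a : (j : Fin N) → G.A j) (b : (j : Fin N) → H.A j) :
    weight (G.comp H) (Function.update (prodProfile p q) i (delta (ai, bi))) (fun j => (a j, b j)) =
      weight G (Function.update p i (delta ai)) a *
        weight H (Function.update q i (delta bi)) b := by
  simp only [weight, ← Finset.prod_mul_distrib]
  refine Finset.prod_congr rfl fun j _ => ?_
  rcases eq_or_ne j i with rfl | hj
  · rw [Function.update_self, Function.update_self, Function.update_self]
    exact delta_prod ai bi (a j, b j)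
  · simp only [Function.update_of_ne hj, prodProfile]

lemma payLottery_comp {G H : Game N} (p : Profile G) (q : Profile H) (i : Fin N) (ai : G.A i)
    (bi : H.A i) :
    payLottery (G.comp H) (prodProfile p q) i (ai, bi) =
      payLottery G p i ai * payLottery H q i bi := by
  let e : ((j : Fin N) → (G.comp H).A j) ≃ ((j : Fin N) → G.A j) × ((j : Fin N) → H.A j) :=
    { toFun := fun c => (fun j => (c j).1, fun j => (c j).2)
      invFun := fun ab j => (ab.1 j, ab.2 j) }
  unfold payLottery
  rw [Finset.sum_mul_sum, ← Fintype.sum_prod_type']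
  refine Fintype.sum_equiv e _ _ fun c => ?_
  rw [AddMonoidAlgebra.single_mul_single, ← weight_comp]
  rfl

lemma update_comp_perm {ι : Type*} [DecidableEq ι] {β : ι → Type*} (π : Equiv.Perm ι)
    (p : (j : ι) → β j) (i : ι) (x : β (π i)) (j : ι) :
    Function.update (β := fun k => β (π k)) (fun k => p (π k)) i x j =
      Function.update p (π i) x (π j) := by
  rcases eq_or_ne j i with rfl | hj
  · rw [Function.update_self, Function.update_self]
  · rw [Function.update_of_ne hj, Function.update_of_ne (π.injective.ne hj)]

lemma payLottery_permute (G : Game N) (π : Equiv.Perm (Fin N)) (p : Profile G) (i : Fin N)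
    (ai : G.A (π i)) :
    payLottery (G.permute π) (fun j => p (π j)) i ai = payLottery G p (π i) ai := by
  refine Fintype.sum_equiv (Equiv.piCongrLeft G.A π) _ _ fun b => ?_
  have hb : (fun j => cast (congrArg G.A (π.apply_symm_apply j)) (b (π.symm j))) =
      Equiv.piCongrLeft G.A π b := by
    funext j
    obtain ⟨k, rfl⟩ := π.surjective j
    rw [Equiv.piCongrLeft_apply_apply]
    refine eq_of_heq ((cast_heq _ _).trans ?_)
    rw [π.symm_apply_apply]
  congr 1
  · exact congrArg (fun a => G.u a (π i)) hb
  · refine Fintype.prod_equiv π _ _ fun j => ?_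
    rw [Equiv.piCongrLeft_apply_apply]
    exact congrFun (update_comp_perm π p i (delta ai) j) (b j)

/-- The game in which player `i` receives `c` for playing `true` and nothing otherwise. -/
def sureGame (i : Fin N) (c : ℝ) : Game N where
  A := fun _ => Bool
  fintypeA := fun _ => inferInstance
  nonemptyA := fun _ => inferInstance
  u := fun a _ => if a i then c else 0

lemma payLottery_sureGame (i : Fin N) (c : ℝ) {p : Profile (sureGame i c)}
    (hp : IsMixed (sureGame i c) p) (b : Bool) :
    payLottery (sureGame i c) p i b = sure (if b then c else 0) := by
  have hq := isMixed_update_delta hp i b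
  have key : ∀ a : (j : Fin N) → (sureGame i c).A j,
      AddMonoidAlgebra.single ((sureGame i c).u a i)
        (weight (sureGame i c) (Function.update p i (delta b)) a) =
      AddMonoidAlgebra.single (if b then c else 0)
        (weight (sureGame i c) (Function.update p i (delta b)) a) := by
    intro a
    by_cases hab : a i = b
    · simp only [sureGame, hab]
    · have : weight (sureGame i c) (Function.update p i (delta b)) a = 0 := by
        refine Finset.prod_eq_zero (Finset.mem_univ i) ?_
        rw [Function.update_self]
        exact if_neg hab
      rw [this, AddMonoidAlgebra.single_zero, AddMonoidAlgebra.single_zero]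
  refine (Finset.sum_congr rfl fun a _ => key a).trans ?_
  unfold sure
  ext1
  simp only [AddMonoidAlgebra.coeff_sum, AddMonoidAlgebra.coeff_single]
  rw [← Finsupp.single_finsetSum, sum_weight hq]

lemma cdfOf_coeff (f : AddMonoidAlgebra ℝ ℝ) (t : ℝ) : cdfOf f.coeff t = cdf f t := by
  rw [cdfOf, cdf, pairing, Finsupp.sum, finsum_eq_sum_of_support_subset (s := f.coeff.support)]
  · simp
  · intro x hx
    simp only [Function.mem_support, ne_eq, ite_eq_right_iff, Classical.not_imp] at hx
    simpa using hx.2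

lemma conv_coeff (f g : AddMonoidAlgebra ℝ ℝ) : conv f.coeff g.coeff = ⇑(f * g).coeff := by
  ext z
  rw [conv, AddMonoidAlgebra.coeff_mul_apply_left, Finsupp.sum,
    finsum_eq_sum_of_support_subset (s := f.coeff.support)]
  · simp [sub_eq_add_neg, add_comm]
  · intro x hx
    simp only [Function.mem_support] at hx
    simpa using left_ne_zero_of_mul hx

lemma dominates_iff {X Y : lotteries} :
    Dominates X Y ↔ FOSDgeF (X : AddMonoidAlgebra ℝ ℝ).coeff (Y : AddMonoidAlgebra ℝ ℝ).coeff := by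
  simp only [Dominates, FOSDgeF, cdfOf_coeff]

lemma exists_lottery {f : ℝ → ℝ} (hf : IsFinLottery f) :
    ∃ X : lotteries, ⇑(X : AddMonoidAlgebra ℝ ℝ).coeff = f := by
  obtain ⟨hf0, hfin, hsum⟩ := hf
  refine ⟨⟨.ofCoeff (Finsupp.ofSupportFinite f hfin), hf0, ?_⟩, rfl⟩
  refine Eq.trans ?_ hsum
  refine Eq.trans ?_ (finsum_eq_sum_of_support_subset f (s := hfin.toFinset) (by simp)).symm
  simp only [pairing, Finsupp.sum, mul_one]
  rfl

open Classical in
/-- The extension by zero of a functional on lotteries to all functions `ℝ → ℝ`. -/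
def extendStatistic (φ : lotteries → ℝ) (f : ℝ → ℝ) : ℝ :=
  if h : ∃ X : lotteries, ⇑(X : AddMonoidAlgebra ℝ ℝ).coeff = f then φ h.choose else 0

lemma extendStatistic_coeff (φ : lotteries → ℝ) (X : lotteries) :
    extendStatistic φ (X : AddMonoidAlgebra ℝ ℝ).coeff = φ X := by
  have h : ∃ Y : lotteries,
    ⇑(Y : AddMonoidAlgebra ℝ ℝ).coeff = (X : AddMonoidAlgebra ℝ ℝ).coeff := ⟨X, rfl⟩
  rw [extendStatistic, dif_pos h]
  congr 1
  ext1
  exact AddMonoidAlgebra.coeff_injective (DFunLike.coe_injective h.choose_spec)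

lemma mas_extendStatistic {φ : lotteries → ℝ} (hadd : ∀ X Y, φ (X * Y) = φ X + φ Y)
    (hmono : ∀ X Y, Dominates X Y → φ Y ≤ φ X) (hsure : ∀ c, φ (sure c) = c) :
    MAS (extendStatistic φ) := by
  refine ⟨fun c => ?_, fun f g hf hg => ?_, fun f g hf hg h => ?_⟩
  · have : delta c = ⇑(sure c : AddMonoidAlgebra ℝ ℝ).coeff := by
      ext x
      simp [sure, delta, Finsupp.single_apply, eq_comm]
    rw [this, extendStatistic_coeff, hsure]
  · obtain ⟨X, rfl⟩ := exists_lottery hf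
    obtain ⟨Y, rfl⟩ := exists_lottery hg
    rw [conv_coeff, ← Submonoid.coe_mul, extendStatistic_coeff, extendStatistic_coeff,
      extendStatistic_coeff, hadd]
  · obtain ⟨X, rfl⟩ := exists_lottery hf
    obtain ⟨Y, rfl⟩ := exists_lottery hg
    rw [extendStatistic_coeff, extendStatistic_coeff]
    exact hmono X Y (dominates_iff.2 h)

/-- `X, Y` are the payoff lotteries and `x, y` the probabilities of two actions of player `i` in
some solution of some game. -/
def SolutionData (S : SolCon N) (i : Fin N) (X Y : lotteries) (x y : ℝ) : Prop :=
  ∃ (G : Game N) (p : Profile G), p ∈ S G ∧ ∃ ai bi : G.A i,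
    X.1 = payLottery G p i ai ∧ Y.1 = payLottery G p i bi ∧ x = p i ai ∧ y = p i bi

lemma isChoiceData_solutionData {S : SolCon N} (hS : IsSolutionConcept S) (hBr : Bracketing S)
    (hDM : DistributionMonotone S) (i : Fin N) : IsChoiceData (SolutionData S i) where
  nonneg := by
    rintro X Y _ _ ⟨G, p, hp, ai, bi, -, -, rfl, -⟩
    exact ((hS G).2 p hp i).1 ai
  swap := by
    rintro X Y x y ⟨G, p, hp, ai, bi, hX, hY, hx, hy⟩
    exact ⟨G, p, hp, bi, ai, hY, hX, hy, hx⟩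
  mul := by
    rintro X Y _ _ X' Y' _ _ ⟨G, p, hp, ai, bi, hX, hY, rfl, rfl⟩
      ⟨H, q, hq, ci, di, hX', hY', rfl, rfl⟩
    refine ⟨G.comp H, prodProfile p q, hBr G H p q hp hq, (ai, ci), (bi, di), ?_, ?_, rfl, rfl⟩
    · rw [payLottery_comp, Submonoid.coe_mul, hX, hX']
    · rw [payLottery_comp, Submonoid.coe_mul, hY, hY']
  mono := by
    rintro X Y _ _ ⟨G, p, hp, ai, bi, hX, hY, rfl, rfl⟩ hd hne
    refine hDM G p hp i ai bi ⟨?_, fun h => hne ?_⟩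
    · rw [← coeff_payLottery, ← coeff_payLottery, ← hX, ← hY]
      exact dominates_iff.1 hd
    · rw [← coeff_payLottery, ← coeff_payLottery, ← hX, ← hY] at h
      ext1
      exact AddMonoidAlgebra.coeff_injective (DFunLike.coe_injective h)
  exists_pos := by
    rintro X Y _ _ ⟨G, p, hp, ai, bi, hX, hY, rfl, rfl⟩
    have hmix := (hS G).2 p hp
    obtain ⟨ci, hci⟩ : ∃ ci, 0 < p i ci := by
      by_contra! h
      linarith [(hmix i).2, Finset.sum_nonpos fun c (_ : c ∈ Finset.univ) => h c]
    exact ⟨⟨payLottery G p i ci, payLottery_mem hmix i ci⟩, p i ci, hci, G, p, hp, ci, ai, rfl, hX,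
      rfl, rfl⟩
  sure := by
    intro c
    obtain ⟨p, hp⟩ := (hS (sureGame i c)).1
    have hmix := (hS _).2 p hp
    refine ⟨p i true, p i false, ?_, sureGame i c, p, hp, true, false, ?_, ?_, rfl, rfl⟩
    · rw [← (hmix i).2]
      exact (Fintype.sum_bool (p i)).symm
    · rw [payLottery_sureGame i c hmix, if_pos rfl]
    · rw [payLottery_sureGame i c hmix, if_neg Bool.false_ne_true, sure_zero]

lemma solutionData_of_anonymity {S : SolCon N} (hS : IsSolutionConcept S) (hAn : Anonymity S)
    (i₀ : Fin N) {G : Game N} {p : Profile G} (hp : p ∈ S G) (i : Fin N) (ai bi : G.A i) :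
    SolutionData S i₀ ⟨payLottery G p i ai, payLottery_mem ((hS G).2 p hp) i ai⟩
      ⟨payLottery G p i bi, payLottery_mem ((hS G).2 p hp) i bi⟩ (p i ai) (p i bi) := by
  obtain ⟨π, rfl⟩ : ∃ π : Equiv.Perm (Fin N), i = π i₀ :=
    ⟨Equiv.swap i₀ i, (Equiv.swap_apply_left i₀ i).symm⟩
  exact ⟨G.permute π, fun j => p (π j), hAn π G p hp, ai, bi,
    (payLottery_permute G π p i₀ ai).symm, (payLottery_permute G π p i₀ bi).symm, rfl, rfl⟩

lemma extendStatistic_payMass (φ : lotteries → ℝ) {G : Game N} {p : Profile G}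
    (hp : IsMixed G p) (i : Fin N) (ai : G.A i) :
    extendStatistic φ (payMass G p i ai) = φ ⟨payLottery G p i ai, payLottery_mem hp i ai⟩ := by
  rw [← coeff_payLottery]
  exact extendStatistic_coeff φ ⟨_, payLottery_mem hp i ai⟩

lemma eq_logit_of_log_sub_log {ι : Type*} [Fintype ι] {x v : ι → ℝ} (hpos : ∀ a, 0 < x a)
    (hsum : ∑ a, x a = 1) (h : ∀ a b, Real.log (x a) - Real.log (x b) = v a - v b) (a : ι) :
    x a = Real.exp (v a) / ∑ b, Real.exp (v b) := by
  have hb : ∀ b, Real.exp (v b) = Real.exp (v a) / x a * x b := by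
    intro b
    rw [← Real.exp_log (hpos b), ← Real.exp_log (hpos a), ← Real.exp_sub, ← Real.exp_add]
    congr 1
    linarith [h a b]
  have hS : ∑ b, Real.exp (v b) = Real.exp (v a) / x a := by
    rw [Finset.sum_congr rfl fun b _ => hb b, ← Finset.mul_sum, hsum, mul_one]
  rw [hS]
  have := (hpos a).ne'
  field_simp

/-- bracketing + distribution-monotonicity + anonymity imply that `S`
refines some statistic response equilibrium (`Nash_Φ` or `LQRE_{λΦ}`). -/
theorem stmt5 {N : ℕ} (hN : 2 ≤ N) (S : SolCon N) (hS : IsSolutionConcept S)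
    (hBr : Bracketing S) (hDM : DistributionMonotone S) (hAn : Anonymity S) :
    ∃ Φ : (ℝ → ℝ) → ℝ, MAS Φ ∧
      ((∀ G, ∀ p ∈ S G, IsNashPhi Φ G p) ∨
        ∃ lam : ℝ, 0 ≤ lam ∧ ∀ G, ∀ p ∈ S G, IsLQREPhi Φ lam G p) := by
  obtain ⟨φ, hadd, hmono, hsure, hφ⟩ :=
    (isChoiceData_solutionData hS hBr hDM ⟨0, by omega⟩).dichotomy
  refine ⟨extendStatistic φ, mas_extendStatistic hadd hmono hsure, ?_⟩
  rcases hφ with hφ | ⟨lam, hlam, hφ⟩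
  · refine Or.inl fun G p hp i ai hai bi => ?_
    rw [extendStatistic_payMass φ ((hS G).2 p hp), extendStatistic_payMass φ ((hS G).2 p hp)]
    exact hφ _ _ _ _ (solutionData_of_anonymity hS hAn _ hp i ai bi) hai
  · refine Or.inr ⟨lam, hlam, fun G p hp i ai => ?_⟩
    have h := fun ai bi => hφ _ _ _ _ (solutionData_of_anonymity hS hAn _ hp i ai bi)
    simp only [extendStatistic_payMass φ ((hS G).2 p hp)]
    exact eq_logit_of_log_sub_log (fun a => (h a a).1) ((hS G).2 p hp i).2
      (fun a b => (h a b).2) ai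

end Paper
end
end

section
/- Let S be a solution concept that permits bracketing and satisfies distribution-monotonicity and anonymity. Then exactly one of the following two statements holds: (1) for every game G, every p∈S(G) is an FOSD-Nash; (2) for every game G, every p∈S(G) is an FOSD-QRE. -/
open Filter Topology MeasureTheory

noncomputable section

namespace Paper

/-! ## Payoff lotteries, composition and relabelling of players -/

section PayoffLotteries

variable {N : ℕ}

lemma IsMixed.update_delta {G : Game N} {p : Profile G} (hp : IsMixed G p) (i : Fin N)
    (x : G.A i) : IsMixed G (Function.update p i (delta x)) := by
  classical
  intro l
  rcases eq_or_ne l i with rfl | h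
  · rw [Function.update_self]
    refine ⟨fun y => ?_, by simp [delta]⟩
    unfold delta
    split_ifs <;> norm_num
  · rw [Function.update_of_ne h]
    exact hp l

lemma weight_nonneg {G : Game N} {p : Profile G} (hp : IsMixed G p) (a : ∀ j, G.A j) :
    0 ≤ weight G p a :=
  Finset.prod_nonneg fun j _ => (hp j).1 _

lemma sum_weight_mul {G : Game N} {p : Profile G} (hp : IsMixed G p) (j : Fin N)
    (φ : G.A j → ℝ) : ∑ a, weight G p a * φ (a j) = ∑ c, p j c * φ c := by
  classical
  have h1 : ∀ a : ∀ l, G.A l, weight G p a * φ (a j) =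
      ∏ l, Function.update p j (fun c => p j c * φ c) l (a l) := by
    intro a
    rw [weight, ← Finset.mul_prod_erase _ _ (Finset.mem_univ j),
      ← Finset.mul_prod_erase _ (fun l => Function.update p j _ l (a l)) (Finset.mem_univ j),
      Function.update_self, mul_right_comm]
    congr 1
    refine Finset.prod_congr rfl fun l hl => ?_
    rw [Function.update_of_ne (Finset.ne_of_mem_erase hl)]
  rw [Finset.sum_congr rfl fun a _ => h1 a, ← Fintype.prod_sum,
    ← Finset.mul_prod_erase _ _ (Finset.mem_univ j), Function.update_self,
    Finset.prod_eq_one, mul_one]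
  intro l hl
  rw [Function.update_of_ne (Finset.ne_of_mem_erase hl)]
  exact (hp l).2

lemma weight_update_delta_of_ne {G : Game N} (p : Profile G) {i : Fin N} {x : G.A i}
    {a : ∀ j, G.A j} (h : a i ≠ x) : weight G (Function.update p i (delta x)) a = 0 :=
  Finset.prod_eq_zero (Finset.mem_univ i) (by simp [delta, h])

lemma expPayOf_mono {G : Game N} {p : Profile G} (hp : IsMixed G p) (i : Fin N) (x : G.A i)
    {φ ψ : ℝ → ℝ} (h : ∀ a, φ (G.u a i) ≤ ψ (G.u a i)) :
    expPayOf G p i x φ ≤ expPayOf G p i x ψ :=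
  Finset.sum_le_sum fun a _ =>
    mul_le_mul_of_nonneg_left (h a) (weight_nonneg (hp.update_delta i x) a)

lemma expPayOf_lt {G : Game N} {p : Profile G} (hp : IsMixed G p) (i : Fin N) (x : G.A i)
    {φ ψ : ℝ → ℝ} (h : ∀ a, φ (G.u a i) ≤ ψ (G.u a i)) (a : ∀ j, G.A j)
    (ha : 0 < weight G (Function.update p i (delta x)) a) (hlt : φ (G.u a i) < ψ (G.u a i)) :
    expPayOf G p i x φ < expPayOf G p i x ψ :=
  Finset.sum_lt_sum
    (fun b _ => mul_le_mul_of_nonneg_left (h b) (weight_nonneg (hp.update_delta i x) b))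
    ⟨a, Finset.mem_univ a, mul_lt_mul_of_pos_left hlt ha⟩

lemma expPayOf_const {G : Game N} {p : Profile G} (hp : IsMixed G p) (i : Fin N) (x : G.A i)
    (c : ℝ) : expPayOf G p i x (fun _ => c) = c := by
  rw [expPayOf, ← Finset.sum_mul, sum_weight (hp.update_delta i x), one_mul]

lemma payMass_eq (G : Game N) (p : Profile G) (i : Fin N) (x : G.A i) (t : ℝ) :
    payMass G p i x t = expPayOf G p i x (fun s => if s = t then 1 else 0) := by
  simp [payMass, expPayOf]

lemma cdfOf_payMass (G : Game N) (p : Profile G) (i : Fin N) (x : G.A i) (t : ℝ) :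
    cdfOf (payMass G p i x) t = expPayOf G p i x (fun s => if s ≤ t then 1 else 0) := by
  classical
  have h : ∀ y, (if y ≤ t then payMass G p i x y else 0) = ∑ a : ∀ j, G.A j,
      if G.u a i = y then
        (if y ≤ t then weight G (Function.update p i (delta x)) a else 0) else 0 := by
    intro y
    unfold payMass
    split_ifs <;> simp
  rw [cdfOf, finsum_congr h, finsum_sum_comm]
  · refine Finset.sum_congr rfl fun a _ => ?_
    rw [finsum_eq_single _ (G.u a i)]
    · simp
    · intro y hy
      rw [if_neg hy.symm]
  · intro a _
    refine (Set.finite_singleton (G.u a i)).subset fun y hy => ?_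
    by_contra hne
    exact hy (if_neg fun h => hne h.symm)

lemma cdfOf_payMass_mono {G : Game N} {p : Profile G} (hp : IsMixed G p) (i : Fin N)
    (x : G.A i) : Monotone (cdfOf (payMass G p i x)) := by
  intro s t hst
  rw [cdfOf_payMass, cdfOf_payMass]
  refine expPayOf_mono hp i x fun a => ?_
  split_ifs <;> first | (exfalso; linarith) | norm_num

lemma cdfOf_payMass_nonneg {G : Game N} {p : Profile G} (hp : IsMixed G p) (i : Fin N)
    (x : G.A i) (t : ℝ) : 0 ≤ cdfOf (payMass G p i x) t := by
  rw [cdfOf_payMass]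
  refine (expPayOf_const hp i x 0).ge.trans (expPayOf_mono hp i x fun a => ?_)
  split_ifs <;> norm_num

lemma cdfOf_payMass_le_one {G : Game N} {p : Profile G} (hp : IsMixed G p) (i : Fin N)
    (x : G.A i) (t : ℝ) : cdfOf (payMass G p i x) t ≤ 1 := by
  rw [cdfOf_payMass]
  refine (expPayOf_mono hp i x fun a => ?_).trans (expPayOf_const hp i x 1).le
  split_ifs <;> norm_num

lemma exists_payoff_bound (G : Game N) (i : Fin N) : ∃ M : ℝ, 0 ≤ M ∧ ∀ a, |G.u a i| ≤ M := by
  obtain ⟨M, hM⟩ := (Set.finite_range fun a => |G.u a i|).bddAbove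
  exact ⟨max M 0, le_max_right _ _, fun a => (hM ⟨a, rfl⟩).trans (le_max_left _ _)⟩

lemma cdfOf_payMass_eq_zero {G : Game N} {p : Profile G} {i : Fin N} {x : G.A i} {M t : ℝ}
    (hM : ∀ a, |G.u a i| ≤ M) (ht : t < -M) : cdfOf (payMass G p i x) t = 0 := by
  rw [cdfOf_payMass]
  refine Finset.sum_eq_zero fun a _ => ?_
  have := (abs_le.1 (hM a)).1
  dsimp only
  rw [if_neg (by linarith), mul_zero]

lemma cdfOf_payMass_eq_one {G : Game N} {p : Profile G} (hp : IsMixed G p) {i : Fin N}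
    {x : G.A i} {M t : ℝ} (hM : ∀ a, |G.u a i| ≤ M) (ht : M ≤ t) :
    cdfOf (payMass G p i x) t = 1 := by
  rw [cdfOf_payMass]
  refine (Finset.sum_congr rfl fun a _ => ?_).trans (expPayOf_const hp i x 1)
  have := (abs_le.1 (hM a)).2
  dsimp only
  rw [if_pos (by linarith)]

lemma exists_right_const (G : Game N) (i : Fin N) (τ : ℝ) :
    ∃ g > 0, ∀ (p : Profile G) (x : G.A i) (t : ℝ), τ ≤ t → t < τ + g →
      cdfOf (payMass G p i x) t = cdfOf (payMass G p i x) τ := by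
  have h : ∀ a : ∀ j, G.A j, ∀ᶠ g in 𝓝[>] (0 : ℝ), τ < G.u a i → τ + g ≤ G.u a i := by
    intro a
    by_cases ha : τ < G.u a i
    · filter_upwards [Ioo_mem_nhdsGT (sub_pos.2 ha)] with g hg _
      linarith [hg.2]
    · exact Eventually.of_forall fun g h => absurd h ha
  obtain ⟨g, hg, hg0⟩ := ((eventually_all.2 h).and self_mem_nhdsWithin).exists
  refine ⟨g, hg0, fun p x t h1 h2 => ?_⟩
  rw [cdfOf_payMass, cdfOf_payMass]
  refine Finset.sum_congr rfl fun a _ => ?_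
  congr 1
  refine if_congr ⟨fun h => ?_, fun h => h.trans h1⟩ rfl rfl
  by_contra hlt
  linarith [hg a (not_le.1 hlt)]

lemma payMass_eq_cdfOf_sub (G : Game N) (i : Fin N) (t : ℝ) :
    ∃ s, ∀ (p : Profile G) (x : G.A i),
      payMass G p i x t = cdfOf (payMass G p i x) t - cdfOf (payMass G p i x) s := by
  have h : ∀ a : ∀ j, G.A j, ∀ᶠ s in 𝓝[<] t, G.u a i < t → G.u a i ≤ s := by
    intro a
    by_cases ha : G.u a i < t
    · filter_upwards [Ioo_mem_nhdsLT ha] with s hs _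
      exact hs.1.le
    · exact Eventually.of_forall fun g h => absurd h ha
  obtain ⟨s, hs, hst⟩ := ((eventually_all.2 h).and self_mem_nhdsWithin).exists
  refine ⟨s, fun p x => ?_⟩
  rw [payMass_eq, cdfOf_payMass, cdfOf_payMass]
  simp only [expPayOf, ← Finset.sum_sub_distrib, ← mul_sub]
  refine Finset.sum_congr rfl fun a _ => ?_
  congr 1
  have hst' : s < t := hst
  rcases lt_trichotomy (G.u a i) t with hlt | heq | hgt
  · rw [if_neg hlt.ne, if_pos hlt.le, if_pos (hs a hlt), sub_self]
  · rw [if_pos heq, if_pos heq.le, if_neg (by linarith), sub_zero]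
  · rw [if_neg hgt.ne', if_neg (by linarith), if_neg (by linarith), sub_self]

lemma payMass_eq_of_cdfOf_eq {G : Game N} {p : Profile G} {i : Fin N} {x y : G.A i}
    (h : ∀ t, cdfOf (payMass G p i x) t = cdfOf (payMass G p i y) t) :
    payMass G p i x = payMass G p i y := by
  funext t
  obtain ⟨s, hs⟩ := payMass_eq_cdfOf_sub G i t
  rw [hs, hs, h, h]

lemma exists_cdfOf_lt {G : Game N} {p : Profile G} {i : Fin N} {x y : G.A i}
    (h : FOSDgtF (payMass G p i x) (payMass G p i y)) :
    ∃ τ, cdfOf (payMass G p i x) τ < cdfOf (payMass G p i y) τ := by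
  by_contra! hle
  exact h.2 (payMass_eq_of_cdfOf_eq fun t => (h.1 t).antisymm (hle t))

/-- The action of the composite game that plays `x` in `G` and `y` in `H`. -/
def pairAction {G H : Game N} {i : Fin N} (x : G.A i) (y : H.A i) : (G.comp H).A i := (x, y)

lemma prodProfile_pairAction {G H : Game N} (p : Profile G) (q : Profile H) (i : Fin N)
    (x : G.A i) (y : H.A i) : prodProfile p q i (pairAction x y) = p i x * q i y := rfl

lemma expPayOf_comp (G H : Game N) (p : Profile G) (q : Profile H) (i : Fin N) (x : G.A i)
    (y : H.A i) (φ : ℝ → ℝ) :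
    expPayOf (G.comp H) (prodProfile p q) i (pairAction x y) φ =
      expPayOf G p i x (fun s => expPayOf H q i y (fun r => φ (s + r))) := by
  classical
  let e : (∀ j, (G.comp H).A j) ≃ (∀ j, G.A j) × (∀ j, H.A j) :=
    { toFun := fun c => (fun j => (c j).1, fun j => (c j).2)
      invFun := fun c j => (c.1 j, c.2 j)
      left_inv := fun _ => rfl
      right_inv := fun _ => rfl }
  have hw : ∀ c : ∀ j, (G.comp H).A j,
      weight (G.comp H) (Function.update (prodProfile p q) i (delta (pairAction x y))) c =
        weight G (Function.update p i (delta x)) (e c).1 *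
          weight H (Function.update q i (delta y)) (e c).2 := by
    intro c
    rw [weight, weight, weight, ← Finset.prod_mul_distrib]
    refine Finset.prod_congr rfl fun l _ => ?_
    rcases eq_or_ne l i with rfl | h
    · simp only [Function.update_self, delta]
      have : (c l = pairAction x y) ↔ ((c l).1 = x ∧ (c l).2 = y) := Prod.ext_iff
      change _ = (if (c l).1 = x then (1 : ℝ) else 0) * (if (c l).2 = y then (1 : ℝ) else 0)
      by_cases h1 : (c l).1 = x <;> by_cases h2 : (c l).2 = y <;> simp [this, h1, h2]
    · simp only [Function.update_of_ne h]
      rfl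
  simp only [expPayOf, Finset.mul_sum]
  rw [← Fintype.sum_prod_type']
  refine Fintype.sum_equiv e _ _ fun c => ?_
  rw [hw c, mul_assoc]
  rfl

lemma cdfOf_comp (G H : Game N) (p : Profile G) (q : Profile H) (i : Fin N) (x : G.A i)
    (y : H.A i) (t : ℝ) :
    cdfOf (payMass (G.comp H) (prodProfile p q) i (pairAction x y)) t =
      expPayOf G p i x (fun s => cdfOf (payMass H q i y) (t - s)) := by
  rw [cdfOf_payMass, expPayOf_comp]
  congr 1
  funext s
  rw [cdfOf_payMass]
  congr 1
  funext r
  exact if_congr le_sub_iff_add_le'.symm rfl rfl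

lemma cdfOf_comp' (G H : Game N) (p : Profile G) (q : Profile H) (i : Fin N) (x : G.A i)
    (y : H.A i) (t : ℝ) :
    cdfOf (payMass (G.comp H) (prodProfile p q) i (pairAction x y)) t =
      expPayOf H q i y (fun s => cdfOf (payMass G p i x) (t - s)) := by
  rw [cdfOf_payMass, expPayOf_comp]
  simp only [cdfOf_payMass, expPayOf, Finset.mul_sum]
  rw [Finset.sum_comm]
  refine Finset.sum_congr rfl fun b _ => Finset.sum_congr rfl fun a _ => ?_
  rw [mul_left_comm]
  congr 2
  exact if_congr le_sub_iff_add_le.symm rfl rfl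

/-- The profile of `G.permute π` in which each player inherits the strategy of `π i`. -/
def permProfile {G : Game N} (p : Profile G) (π : Equiv.Perm (Fin N)) :
    Profile (G.permute π) := fun i => p (π i)

/-- An action of player `π j` as an action of player `j` in `G.permute π`. -/
def permAction {G : Game N} {π : Equiv.Perm (Fin N)} {j : Fin N} (x : G.A (π j)) :
    (G.permute π).A j := x

lemma expPayOf_permute (G : Game N) (p : Profile G) (π : Equiv.Perm (Fin N)) (j : Fin N)
    (x : G.A (π j)) (φ : ℝ → ℝ) :
    expPayOf (G.permute π) (permProfile p π) j (permAction x) φ = expPayOf G p (π j) x φ := by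
  have hcast : ∀ (b : ∀ l, G.A l) (l m : Fin N) (h : l = m),
      cast (congrArg G.A h) (b l) = b m := by
    rintro b l _ rfl
    rfl
  have hcast' : ∀ (b : ∀ l, G.A (π l)) (l m : Fin N) (h : l = m),
      cast (congrArg (fun k => G.A (π k)) h) (b l) = b m := by
    rintro b l _ rfl
    rfl
  let f : (∀ l, G.A l) → (∀ l, (G.permute π).A l) := fun a l => a (π l)
  have hf : Function.Bijective f := by
    constructor
    · intro a b hab
      funext l
      obtain ⟨k, rfl⟩ := π.surjective l
      exact congrFun hab k
    · intro b
      refine ⟨fun l => cast (congrArg G.A (π.apply_symm_apply l)) (b (π.symm l)), ?_⟩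
      funext l
      exact hcast' b _ _ (π.symm_apply_apply l)
  refine ((Fintype.sum_bijective f hf _ _ fun a => ?_)).symm
  congr 1
  · rw [weight, weight, ← Equiv.prod_comp π]
    refine Finset.prod_congr rfl fun l _ => ?_
    rcases eq_or_ne l j with rfl | h
    · rw [Function.update_self, Function.update_self]
      rfl
    · rw [Function.update_of_ne h, Function.update_of_ne (π.injective.ne h)]
      rfl
  · congr 1
    change G.u a (π j) = G.u (fun l => cast _ (a (π (π.symm l)))) (π j)
    congr 1
    funext l
    exact (hcast a _ _ (π.apply_symm_apply l)).symm

lemma payMass_permute (G : Game N) (p : Profile G) (π : Equiv.Perm (Fin N)) (j : Fin N)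
    (x : G.A (π j)) :
    payMass (G.permute π) (permProfile p π) j (permAction x) = payMass G p (π j) x := by
  funext t
  rw [payMass_eq, payMass_eq, expPayOf_permute]

end PayoffLotteries

/-! ## Consequences of the axioms -/

section Axioms

variable {N : ℕ} {S : SolCon N}

lemma Anonymity.exists_relabel (hAn : Anonymity S) {G : Game N} {p : Profile G} (hp : p ∈ S G)
    {i : Fin N} (j : Fin N) (a b : G.A i) :
    ∃ (G' : Game N) (p' : Profile G') (a' b' : G'.A j), p' ∈ S G' ∧
      payMass G' p' j a' = payMass G p i a ∧ payMass G' p' j b' = payMass G p i b ∧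
      p' j a' = p i a ∧ p' j b' = p i b := by
  obtain ⟨π, rfl⟩ : ∃ π : Equiv.Perm (Fin N), π j = i := ⟨Equiv.swap i j, Equiv.swap_apply_right i j⟩
  exact ⟨G.permute π, permProfile p π, permAction a, permAction b, hAn π G p hp,
    payMass_permute G p π j a, payMass_permute G p π j b, rfl, rfl⟩

/-- An action is played with positive probability at some solution although another action
strictly first-order stochastically dominates it. -/
def PlaysDominated (S : SolCon N) (i : Fin N) : Prop :=
  ∃ (G : Game N) (p : Profile G) (a b : G.A i), p ∈ S G ∧
    FOSDgtF (payMass G p i b) (payMass G p i a) ∧ 0 < p i a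

/-- An action is played with positive probability at some solution although another action
dominates it by the sure amount `L`. -/
def PlaysGapDominated (S : SolCon N) (L : ℝ) (i : Fin N) : Prop :=
  ∃ (G : Game N) (p : Profile G) (a b : G.A i), p ∈ S G ∧
    (∀ t, cdfOf (payMass G p i b) (t + L) ≤ cdfOf (payMass G p i a) t) ∧ 0 < p i a

/-- Weak first-order stochastic dominance is respected by choice probabilities. -/
def WeaklyMonotone (S : SolCon N) : Prop :=
  ∀ (G : Game N) (p : Profile G), p ∈ S G → ∀ i, ∀ a b : G.A i,
    (∀ t, cdfOf (payMass G p i b) t ≤ cdfOf (payMass G p i a) t) → p i a ≤ p i b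

lemma PlaysDominated.relabel (hAn : Anonymity S) {i : Fin N} (h : PlaysDominated S i)
    (j : Fin N) : PlaysDominated S j := by
  obtain ⟨G, p, a, b, hp, hdom, hpos⟩ := h
  obtain ⟨G', p', a', b', hp', ha, hb, hpa, -⟩ := hAn.exists_relabel hp j a b
  exact ⟨G', p', a', b', hp', by rwa [ha, hb], by rwa [hpa]⟩

lemma PlaysGapDominated.relabel (hAn : Anonymity S) {L : ℝ} {i : Fin N}
    (h : PlaysGapDominated S L i) (j : Fin N) : PlaysGapDominated S L j := by
  obtain ⟨G, p, a, b, hp, hdom, hpos⟩ := h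
  obtain ⟨G', p', a', b', hp', ha, hb, hpa, -⟩ := hAn.exists_relabel hp j a b
  exact ⟨G', p', a', b', hp', by rwa [ha, hb], by rwa [hpa]⟩

/-- Adding independent lotteries, one strictly and one weakly dominated, yields a strictly
dominated lottery. -/
lemma fosdgtF_comp {G H : Game N} {p : Profile G} {q : Profile H} (hp : IsMixed G p)
    (hq : IsMixed H q) {i : Fin N} {a b : G.A i} {c d : H.A i}
    (h : FOSDgtF (payMass G p i b) (payMass G p i a))
    (h' : ∀ t, cdfOf (payMass H q i c) t ≤ cdfOf (payMass H q i d) t) :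
    FOSDgtF (payMass (G.comp H) (prodProfile p q) i (pairAction b c))
      (payMass (G.comp H) (prodProfile p q) i (pairAction a d)) := by
  have hmid : ∀ t, cdfOf (payMass (G.comp H) (prodProfile p q) i (pairAction b c)) t ≤
      cdfOf (payMass (G.comp H) (prodProfile p q) i (pairAction b d)) t := fun t => by
    rw [cdfOf_comp, cdfOf_comp]
    exact expPayOf_mono hp i b fun _ => h' _
  refine ⟨fun t => (hmid t).trans ?_, fun heq => ?_⟩
  · rw [cdfOf_comp', cdfOf_comp']
    exact expPayOf_mono hq i d fun _ => h.1 _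
  · obtain ⟨τ, hτ⟩ := exists_cdfOf_lt h
    obtain ⟨e, -, he⟩ : ∃ e ∈ Finset.univ, 0 < weight H (Function.update q i (delta d)) e := by
      refine Finset.exists_lt_of_sum_lt ?_
      rw [sum_weight (hq.update_delta i d), Finset.sum_const_zero]
      exact one_pos
    have hlt : cdfOf (payMass (G.comp H) (prodProfile p q) i (pairAction b d))
          (τ + H.u e i) <
        cdfOf (payMass (G.comp H) (prodProfile p q) i (pairAction a d)) (τ + H.u e i) := by
      rw [cdfOf_comp', cdfOf_comp']
      refine expPayOf_lt hq i d (fun _ => h.1 _) e he ?_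
      simpa using hτ
    have := hmid (τ + H.u e i)
    rw [heq] at this
    exact absurd this (not_le.2 hlt)

lemma PlaysDominated.exists_power (hS : IsSolutionConcept S) (hBr : Bracketing S)
    {G : Game N} {p : Profile G} (hp : p ∈ S G) {i : Fin N} {a b : G.A i}
    (h : FOSDgtF (payMass G p i b) (payMass G p i a)) {H : Game N} {q : Profile H}
    (hq : q ∈ S H) {c d : H.A i}
    (h' : ∀ t, cdfOf (payMass H q i c) t ≤ cdfOf (payMass H q i d) t) (n : ℕ) :
    ∃ (G' : Game N) (p' : Profile G') (a' b' : G'.A i), p' ∈ S G' ∧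
      FOSDgtF (payMass G' p' i b') (payMass G' p' i a') ∧
      p' i a' = p i a * q i d ^ n ∧ p' i b' = p i b * q i c ^ n := by
  induction n with
  | zero => exact ⟨G, p, a, b, hp, h, by simp, by simp⟩
  | succ n ih =>
    obtain ⟨G', p', a', b', hp', hdom, ha, hb⟩ := ih
    refine ⟨G'.comp H, prodProfile p' q, pairAction a' d, pairAction b' c, hBr _ _ _ _ hp' hq,
      fosdgtF_comp ((hS _).2 _ hp') ((hS _).2 _ hq) hdom h', ?_, ?_⟩
    · rw [prodProfile_pairAction, ha, pow_succ, mul_assoc]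
    · rw [prodProfile_pairAction, hb, pow_succ, mul_assoc]

lemma le_of_forall_mul_pow_le {A B x y : ℝ} (hA : 0 < A) (hx : 0 ≤ x)
    (h : ∀ n : ℕ, A * y ^ n ≤ B * x ^ n) : y ≤ x := by
  by_contra! hlt
  have hy : 0 < y := hx.trans_lt hlt
  have hlim : Tendsto (fun n : ℕ => B * (x / y) ^ n) atTop (𝓝 (B * 0)) :=
    (tendsto_pow_atTop_nhds_zero_of_lt_one (div_nonneg hx hy.le)
      ((div_lt_one hy).2 hlt)).const_mul B
  rw [mul_zero] at hlim
  have hle : A ≤ 0 := ge_of_tendsto' hlim fun n => by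
    rw [div_pow, ← mul_div_assoc, le_div_iff₀ (pow_pos hy n)]
    exact h n
  linarith

lemma weaklyMonotone_of_playsDominated (hS : IsSolutionConcept S) (hBr : Bracketing S)
    (hDM : DistributionMonotone S) (h : ∀ i, PlaysDominated S i) : WeaklyMonotone S := by
  intro H q hq i d c hle
  obtain ⟨G, p, a, b, hp, hdom, hpos⟩ := h i
  refine le_of_forall_mul_pow_le hpos (((hS _).2 _ hq i).1 c) (B := p i b) fun n => ?_
  obtain ⟨G', p', a', b', hp', hdom', ha, hb⟩ :=
    PlaysDominated.exists_power hS hBr hp hdom hq hle n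
  rw [← ha, ← hb]
  exact hDM G' p' hp' i b' a' hdom'

lemma PlaysGapDominated.nsmul (hS : IsSolutionConcept S) (hBr : Bracketing S) {L : ℝ}
    {i : Fin N} (h : PlaysGapDominated S L i) (n : ℕ) :
    PlaysGapDominated S ((n + 1 : ℕ) * L) i := by
  obtain ⟨H, q, c, d, hq, hdom, hpos⟩ := h
  induction n with
  | zero => simpa using ⟨H, q, c, d, hq, hdom, hpos⟩
  | succ n ih =>
    obtain ⟨G, p, a, b, hp, hdom', hpos'⟩ := ih
    refine ⟨G.comp H, prodProfile p q, pairAction a c, pairAction b d, hBr _ _ _ _ hp hq,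
      fun t => ?_, by rw [prodProfile_pairAction]; exact mul_pos hpos' hpos⟩
    have h1 : cdfOf (payMass (G.comp H) (prodProfile p q) i (pairAction b d))
          (t + ((n + 1 + 1 : ℕ) : ℝ) * L) ≤
        cdfOf (payMass (G.comp H) (prodProfile p q) i (pairAction b c))
          (t + ((n + 1 : ℕ) : ℝ) * L) := by
      rw [cdfOf_comp, cdfOf_comp]
      refine expPayOf_mono ((hS _).2 _ hp) i b fun s => ?_
      refine le_trans (le_of_eq ?_) (hdom _)
      congr 1
      push_cast
      ring
    refine h1.trans ?_
    rw [cdfOf_comp', cdfOf_comp']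
    refine expPayOf_mono ((hS _).2 _ hq) i c fun s => ?_
    refine le_trans (le_of_eq ?_) (hdom' _)
    congr 1
    ring

lemma WeaklyMonotone.mul_le (hW : WeaklyMonotone S) (hBr : Bracketing S) {G H : Game N}
    {p : Profile G} (hp : p ∈ S G) {q : Profile H} (hq : q ∈ S H) {i : Fin N} {a b : G.A i}
    {c d : H.A i}
    (h : ∀ t, expPayOf H q i c (fun s => cdfOf (payMass G p i b) (t - s)) ≤
      expPayOf H q i d (fun s => cdfOf (payMass G p i a) (t - s))) :
    p i a * q i d ≤ p i b * q i c := by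
  refine hW _ _ (hBr _ _ _ _ hp hq) i (pairAction a d) (pairAction b c) fun t => ?_
  rw [cdfOf_comp', cdfOf_comp']
  exact h t

lemma WeaklyMonotone.isFOSDQRE (hW : WeaklyMonotone S) (hS : IsSolutionConcept S)
    (hBr : Bracketing S) {L : ℝ} (hL : 0 < L) (h : ∀ i, PlaysGapDominated S L i) {H : Game N}
    {q : Profile H} (hq : q ∈ S H) : IsFOSDQRE H q := by
  refine ⟨fun i c => ?_, fun i c d hcd => hW H q hq i d c hcd⟩
  have hqm := (hS _).2 _ hq
  obtain ⟨d, -, hd⟩ : ∃ d ∈ Finset.univ, 0 < q i d := by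
    refine Finset.exists_lt_of_sum_lt ?_
    rw [(hqm i).2, Finset.sum_const_zero]
    exact one_pos
  obtain ⟨M, -, hM⟩ := exists_payoff_bound H i
  obtain ⟨n, hn⟩ := exists_nat_gt (2 * M / L)
  obtain ⟨G, p, a, b, hp, hdom, hpos⟩ := (h i).nsmul hS hBr n
  have hpm := (hS _).2 _ hp
  have hnL : 2 * M ≤ ((n + 1 : ℕ) : ℝ) * L := by
    rw [div_lt_iff₀ hL] at hn
    push_cast
    nlinarith
  have hle : p i a * q i d ≤ p i b * q i c := by
    refine hW.mul_le hBr hp hq fun t => ?_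
    calc expPayOf H q i c (fun s => cdfOf (payMass G p i b) (t - s))
        ≤ expPayOf H q i c (fun _ => cdfOf (payMass G p i b) (t + M)) :=
          expPayOf_mono hqm i c fun e =>
            cdfOf_payMass_mono hpm i b (by linarith [(abs_le.1 (hM e)).1])
      _ = cdfOf (payMass G p i b) (t + M) := expPayOf_const hqm i c _
      _ ≤ cdfOf (payMass G p i b) (t - M + ((n + 1 : ℕ) : ℝ) * L) :=
          cdfOf_payMass_mono hpm i b (by linarith)
      _ ≤ cdfOf (payMass G p i a) (t - M) := hdom _
      _ = expPayOf H q i d (fun _ => cdfOf (payMass G p i a) (t - M)) :=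
          (expPayOf_const hqm i d _).symm
      _ ≤ expPayOf H q i d (fun s => cdfOf (payMass G p i a) (t - s)) :=
          expPayOf_mono hqm i d fun e =>
            cdfOf_payMass_mono hpm i a (by linarith [(abs_le.1 (hM e)).2])
  refine lt_of_le_of_ne ((hqm i).1 c) fun h0 => ?_
  rw [← h0, mul_zero] at hle
  exact absurd hle (not_le.2 (mul_pos hpos hd))

end Axioms

/-! ## Games with two active players -/

section Duel

variable {N : ℕ} {α β : Type} [Fintype α] [Fintype β] [Nonempty α] [Nonempty β]

/-- The game in which only players `i` and `j` are active. For uniformity all action sets are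
`α × β`; only the `α`-component of `i`'s action and the `β`-component of `j`'s action matter. -/
def duel (i j : Fin N) (f g : α → β → ℝ) : Game N where
  A := fun _ => α × β
  fintypeA := fun _ => inferInstance
  nonemptyA := fun _ => inferInstance
  u := fun a l => if l = i then f (a i).1 (a j).2 else if l = j then g (a i).1 (a j).2 else 0

/-- A pair `(x, y)` as an action of player `l` in a duel. -/
def duelAction {i j : Fin N} {f g : α → β → ℝ} (l : Fin N) (x : α) (y : β) :
    (duel i j f g).A l := (x, y)

/-- The distribution of the `α`-component of player `i`'s strategy in a duel. -/
def rowMarginal {i j : Fin N} {f g : α → β → ℝ} (p : Profile (duel i j f g)) (x : α) : ℝ :=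
  ∑ y, p i (duelAction i x y)

/-- The distribution of the `β`-component of player `j`'s strategy in a duel. -/
def colMarginal {i j : Fin N} {f g : α → β → ℝ} (p : Profile (duel i j f g)) (y : β) : ℝ :=
  ∑ x, p j (duelAction j x y)

variable {i j : Fin N} {f g : α → β → ℝ} {p : Profile (duel i j f g)}

lemma isDist_rowMarginal (hp : IsMixed (duel i j f g) p) : IsDist (rowMarginal p) :=
  ⟨fun _ => Finset.sum_nonneg fun _ _ => (hp i).1 _,
    (Fintype.sum_prod_type (f := p i)).symm.trans (hp i).2⟩

lemma isDist_colMarginal (hp : IsMixed (duel i j f g) p) : IsDist (colMarginal p) :=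
  ⟨fun _ => Finset.sum_nonneg fun _ _ => (hp j).1 _,
    (Fintype.sum_prod_type_right (f := p j)).symm.trans (hp j).2⟩

lemma expPayOf_duel_row (hij : i ≠ j) (hp : IsMixed (duel i j f g) p) (x : α) (y : β)
    (φ : ℝ → ℝ) :
    expPayOf (duel i j f g) p i (duelAction i x y) φ =
      ∑ c, colMarginal p c * φ (f x c) := by
  have h : ∀ a : ∀ l, (duel i j f g).A l,
      weight _ (Function.update p i (delta (duelAction i x y))) a * φ ((duel i j f g).u a i) =
      weight _ (Function.update p i (delta (duelAction i x y))) a * φ (f x (a j).2) := by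
    intro a
    by_cases ha : a i = duelAction i x y
    · have hu : (duel i j f g).u a i = f (a i).1 (a j).2 := if_pos rfl
      rw [hu, ha]
      rfl
    · rw [weight_update_delta_of_ne p ha, zero_mul, zero_mul]
  rw [expPayOf, Finset.sum_congr rfl fun a _ => h a,
    sum_weight_mul (hp.update_delta i _) j fun c => φ (f x c.2), Function.update_of_ne hij.symm]
  simp only [colMarginal, Finset.sum_mul]
  exact Fintype.sum_prod_type_right (f := fun c : α × β => p j c * φ (f x c.2))

lemma expPayOf_duel_col (hij : i ≠ j) (hp : IsMixed (duel i j f g) p) (x : α) (y : β)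
    (φ : ℝ → ℝ) :
    expPayOf (duel i j f g) p j (duelAction j x y) φ =
      ∑ r, rowMarginal p r * φ (g r y) := by
  have h : ∀ a : ∀ l, (duel i j f g).A l,
      weight _ (Function.update p j (delta (duelAction j x y))) a * φ ((duel i j f g).u a j) =
      weight _ (Function.update p j (delta (duelAction j x y))) a * φ (g (a i).1 y) := by
    intro a
    by_cases ha : a j = duelAction j x y
    · have hu : (duel i j f g).u a j = g (a i).1 (a j).2 := (if_neg hij.symm).trans (if_pos rfl)
      rw [hu, ha]
      rfl
    · rw [weight_update_delta_of_ne p ha, zero_mul, zero_mul]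
  rw [expPayOf, Finset.sum_congr rfl fun a _ => h a,
    sum_weight_mul (hp.update_delta j _) i fun c => φ (g c.1 y), Function.update_of_ne hij]
  simp only [rowMarginal, Finset.sum_mul]
  exact Fintype.sum_prod_type (f := fun c : α × β => p i c * φ (g c.1 y))

lemma cdfOf_duel_row (hij : i ≠ j) (hp : IsMixed (duel i j f g) p) (x : α) (y : β) (t : ℝ) :
    cdfOf (payMass (duel i j f g) p i (duelAction i x y)) t =
      ∑ c, colMarginal p c * if f x c ≤ t then 1 else 0 := by
  rw [cdfOf_payMass, expPayOf_duel_row hij hp]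

lemma cdfOf_duel_col (hij : i ≠ j) (hp : IsMixed (duel i j f g) p) (x : α) (y : β) (t : ℝ) :
    cdfOf (payMass (duel i j f g) p j (duelAction j x y)) t =
      ∑ r, rowMarginal p r * if g r y ≤ t then 1 else 0 := by
  rw [cdfOf_payMass, expPayOf_duel_col hij hp]

variable {S : SolCon N}

lemma rowMarginal_eq_zero (hij : i ≠ j) (hS : IsSolutionConcept S)
    (hp : p ∈ S (duel i j f g)) {L : ℝ} (hA : ¬ PlaysGapDominated S L i) {x x' : α}
    (h : ∀ c, 0 < colMarginal p c → f x c + L ≤ f x' c) : rowMarginal p x = 0 := by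
  have hpm := (hS _).2 _ hp
  refine Finset.sum_eq_zero fun y _ => ?_
  by_contra hne
  refine hA ⟨_, p, duelAction i x y, duelAction i x' y, hp, fun t => ?_,
    lt_of_le_of_ne ((hpm i).1 _) (Ne.symm hne)⟩
  rw [cdfOf_duel_row hij hpm, cdfOf_duel_row hij hpm]
  refine Finset.sum_le_sum fun c _ => ?_
  rcases ((isDist_colMarginal hpm).1 c).eq_or_lt with h0 | h0
  · simp [← h0]
  · refine mul_le_mul_of_nonneg_left ?_ h0.le
    have := h c h0
    split_ifs <;> first | (exfalso; linarith) | norm_num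

lemma colMarginal_eq_zero (hij : i ≠ j) (hS : IsSolutionConcept S)
    (hp : p ∈ S (duel i j f g)) {L : ℝ} (hA : ¬ PlaysGapDominated S L j) {y y' : β}
    (h : ∀ r, 0 < rowMarginal p r → g r y + L ≤ g r y') : colMarginal p y = 0 := by
  have hpm := (hS _).2 _ hp
  refine Finset.sum_eq_zero fun x _ => ?_
  by_contra hne
  refine hA ⟨_, p, duelAction j x y, duelAction j x y', hp, fun t => ?_,
    lt_of_le_of_ne ((hpm j).1 _) (Ne.symm hne)⟩
  rw [cdfOf_duel_col hij hpm, cdfOf_duel_col hij hpm]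
  refine Finset.sum_le_sum fun r _ => ?_
  rcases ((isDist_rowMarginal hpm).1 r).eq_or_lt with h0 | h0
  · simp [← h0]
  · refine mul_le_mul_of_nonneg_left ?_ h0.le
    have := h r h0
    split_ifs <;> first | (exfalso; linarith) | norm_num

lemma WeaklyMonotone.colMarginal_le (hW : WeaklyMonotone S) (hij : i ≠ j)
    (hS : IsSolutionConcept S) (hp : p ∈ S (duel i j f g)) {y y' : β}
    (h : ∀ r, g r y ≤ g r y') : colMarginal p y ≤ colMarginal p y' := by
  have hpm := (hS _).2 _ hp
  refine Finset.sum_le_sum fun x _ => hW _ p hp j _ _ fun t => ?_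
  rw [cdfOf_duel_col hij hpm, cdfOf_duel_col hij hpm]
  refine Finset.sum_le_sum fun r _ => ?_
  refine mul_le_mul_of_nonneg_left ?_ ((isDist_rowMarginal hpm).1 r)
  have := h r
  split_ifs <;> first | (exfalso; linarith) | norm_num

lemma WeaklyMonotone.row_le (hW : WeaklyMonotone S) (hij : i ≠ j)
    (hS : IsSolutionConcept S) (hp : p ∈ S (duel i j f g)) {x x' : α} (y : β)
    (h : ∀ c, f x c ≤ f x' c) : p i (duelAction i x y) ≤ p i (duelAction i x' y) := by
  have hpm := (hS _).2 _ hp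
  refine hW _ p hp i _ _ fun t => ?_
  rw [cdfOf_duel_row hij hpm, cdfOf_duel_row hij hpm]
  refine Finset.sum_le_sum fun c _ => ?_
  refine mul_le_mul_of_nonneg_left ?_ ((isDist_colMarginal hpm).1 c)
  have := h c
  split_ifs <;> first | (exfalso; linarith) | norm_num

lemma IsDist.exists_pos {γ : Type*} [Fintype γ] {μ : γ → ℝ} (h : IsDist μ) : ∃ x, 0 < μ x := by
  obtain ⟨x, -, hx⟩ : ∃ x ∈ Finset.univ, 0 < μ x := by
    refine Finset.exists_lt_of_sum_lt ?_
    rw [h.2, Finset.sum_const_zero]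
    exact one_pos
  exact ⟨x, hx⟩

/-- When the column player is indifferent, the columns are equally likely. -/
lemma WeaklyMonotone.exists_expPayOf_duel_eq (hW : WeaklyMonotone S) (hij : i ≠ j)
    (hS : IsSolutionConcept S) {p : Profile (duel i j f 0)} (hp : p ∈ S (duel i j f 0)) :
    ∃ ν > 0, ∀ x y φ, expPayOf (duel i j f 0) p i (duelAction i x y) φ =
      ν * ∑ c, φ (f x c) := by
  have hpm := (hS _).2 _ hp
  obtain ⟨c₀, hc₀⟩ := (isDist_colMarginal hpm).exists_pos
  refine ⟨_, hc₀, fun x y φ => ?_⟩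
  rw [expPayOf_duel_row hij hpm, Finset.mul_sum]
  refine Finset.sum_congr rfl fun c _ => ?_
  rw [(hW.colMarginal_le hij hS hp (y := c) (y' := c₀) fun _ => le_rfl).antisymm
    (hW.colMarginal_le hij hS hp (y := c₀) (y' := c) fun _ => le_rfl)]

/-- If every solution refines FOSD-Nash, then not every solution refines FOSD-QRE. -/
lemma not_isFOSDNash_and_isFOSDQRE (hij : i ≠ j) (hS : IsSolutionConcept S)
    (h1 : ∀ G, ∀ p ∈ S G, IsFOSDNash G p) (h2 : ∀ G, ∀ p ∈ S G, IsFOSDQRE G p) : False := by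
  let f : Bool → Unit → ℝ := fun x _ => if x then 1 else 0
  obtain ⟨p, hp⟩ := (hS (duel i j f 0)).1
  have hpm := (hS _).2 _ hp
  have hcdf : ∀ x t, cdfOf (payMass (duel i j f 0) p i (duelAction i x ())) t =
      if f x () ≤ t then 1 else 0 := fun x t => by
    have h := (isDist_colMarginal hpm).2
    rw [Fintype.sum_unique] at h
    rw [cdfOf_duel_row hij hpm, Fintype.sum_unique, h, one_mul]
  have hdom : FOSDgtF (payMass (duel i j f 0) p i (duelAction i true ()))
      (payMass (duel i j f 0) p i (duelAction i false ())) := by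
    refine ⟨fun t => ?_, fun heq => ?_⟩
    · rw [hcdf, hcdf]
      simp only [f]
      split_ifs <;> first | (exfalso; linarith) | norm_num
    · have h := hcdf true 0
      rw [heq, hcdf] at h
      norm_num [f] at h
  have hzero := h1 _ p hp i _ ⟨_, hdom⟩
  exact absurd hzero ((h2 _ p hp).1 i _).ne'

end Duel

/-! ## Dominated play forces gap-dominated play -/

section Noise

variable {N : ℕ} {S : SolCon N} {i j : Fin N}

/-- Payoffs of the row player facing `k` copies of a noise term on the grid `{-Z g, …, Z g}`
together with `q` further states. Row `ℓ` yields `g` in the first `ℓ` of these states and `0` in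
the others. -/
def noisePay (k Z q : ℕ) (g : ℝ) (ℓ : Fin (q + 1)) :
    (Fin k × Finset.Icc (-Z : ℤ) Z) ⊕ Fin q → ℝ
  | .inl w => g * (w.2 : ℤ)
  | .inr e => if e.castSucc < ℓ then g else 0

lemma sum_noisePay (k Z q : ℕ) (g : ℝ) (ℓ : Fin (q + 1)) (φ : ℝ → ℝ) :
    ∑ c, φ (noisePay k Z q g ℓ c) = k * ∑ z ∈ Finset.Icc (-Z : ℤ) Z, φ (g * z) +
      ∑ e : Fin q, φ (if e.castSucc < ℓ then g else 0) := by
  rw [Fintype.sum_sum_type, Fintype.sum_prod_type]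
  simp only [noisePay]
  rw [Finset.sum_const, Finset.card_univ, Fintype.card_fin, nsmul_eq_mul,
    Finset.sum_coe_sort (Finset.Icc (-Z : ℤ) Z) fun z => φ (g * z)]

lemma exists_grid_point {g : ℝ} (hg : 0 < g) {T : ℝ} {Z : ℕ} (hZ : T / g + 1 ≤ Z) {t : ℝ}
    (ht : |t| ≤ T) : ∃ z ∈ Finset.Icc (-Z : ℤ) Z, 0 ≤ t - g * z ∧ t - g * z < g := by
  obtain ⟨h1, h2⟩ := abs_le.1 ht
  have hlo : (⌊t / g⌋ : ℝ) ≤ t / g := Int.floor_le _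
  have hhi : t / g < ⌊t / g⌋ + 1 := Int.lt_floor_add_one _
  have h3 : t / g ≤ T / g := by gcongr
  have h4 : -(T / g) ≤ t / g := by rw [← neg_div]; gcongr
  have hmul : g * (t / g) = t := mul_div_cancel₀ t hg.ne'
  refine ⟨⌊t / g⌋, Finset.mem_Icc.2 ⟨?_, ?_⟩, ?_, ?_⟩
  · have : (-Z : ℝ) ≤ ⌊t / g⌋ := by linarith
    exact_mod_cast this
  · have : (⌊t / g⌋ : ℝ) ≤ Z := by linarith
    exact_mod_cast this
  · nlinarith
  · nlinarith

/-- With enough noise, replacing `a` by a dominating `b` compensates for moving one state of the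
noise game from `g` to `0`. -/
lemma sum_noisePay_cdf_le {G : Game N} {p : Profile G} (hp : IsMixed G p) {a b : G.A i}
    {M τ g η : ℝ} (hM : ∀ e, |G.u e i| ≤ M) (hg : 0 < g)
    (hdom : ∀ t, cdfOf (payMass G p i b) t ≤ cdfOf (payMass G p i a) t)
    (hη : ∀ t, τ ≤ t → t < τ + g →
      η ≤ cdfOf (payMass G p i a) t - cdfOf (payMass G p i b) t)
    {k Z : ℕ} (hk : 1 ≤ k * η) (hZ : (M + g + |τ|) / g + 1 ≤ Z) {q : ℕ} (e : Fin q) (t : ℝ) :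
    ∑ c, cdfOf (payMass G p i b) (t - noisePay k Z q g e.castSucc c) ≤
      ∑ c, cdfOf (payMass G p i a) (t - noisePay k Z q g e.succ c) := by
  rw [sum_noisePay k Z q g _ fun s => cdfOf (payMass G p i b) (t - s),
    sum_noisePay k Z q g _ fun s => cdfOf (payMass G p i a) (t - s)]
  set Fa := cdfOf (payMass G p i a)
  set Fb := cdfOf (payMass G p i b)
  have hnoise : 0 ≤ ∑ z ∈ Finset.Icc (-Z : ℤ) Z, (Fa (t - g * z) - Fb (t - g * z)) :=
    Finset.sum_nonneg fun z _ => sub_nonneg.2 (hdom _)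
  have hstates : Fa (t - g) - Fb t ≤ ∑ e' : Fin q, (Fa (t - if e'.castSucc < e.succ then g else 0)
      - Fb (t - if e'.castSucc < e.castSucc then g else 0)) := by
    rw [← Finset.add_sum_erase _ _ (Finset.mem_univ e), if_pos e.castSucc_lt_succ,
      if_neg (lt_irrefl _), sub_zero]
    refine le_add_of_nonneg_right (Finset.sum_nonneg fun e' he' => ?_)
    have hne : e' ≠ e := Finset.ne_of_mem_erase he'
    have hiff : e'.castSucc < e.succ ↔ e'.castSucc < e.castSucc := by
      rw [Fin.castSucc_lt_succ_iff, Fin.castSucc_lt_castSucc_iff]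
      exact ⟨fun h => lt_of_le_of_ne h hne, le_of_lt⟩
    rw [if_congr hiff rfl rfl]
    exact sub_nonneg.2 (hdom _)
  have hk0 : (0 : ℝ) ≤ k := k.cast_nonneg
  have key : 0 ≤ k * ∑ z ∈ Finset.Icc (-Z : ℤ) Z, (Fa (t - g * z) - Fb (t - g * z)) +
      (Fa (t - g) - Fb t) := by
    rcases lt_or_ge t (-M) with h1 | h1
    · have h0 : Fb t = 0 := cdfOf_payMass_eq_zero hM h1
      have h2 : 0 ≤ Fa (t - g) := cdfOf_payMass_nonneg hp i a _
      have := mul_nonneg hk0 hnoise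
      linarith
    rcases le_or_gt (M + g) t with h2 | h2
    · have h0 : Fa (t - g) = 1 := cdfOf_payMass_eq_one hp hM (by linarith)
      have h3 : Fb t ≤ 1 := cdfOf_payMass_le_one hp i b _
      have := mul_nonneg hk0 hnoise
      linarith
    · have habs : |t - τ| ≤ M + g + |τ| := by
        have := le_abs_self τ
        have := neg_abs_le τ
        rw [abs_le]
        constructor <;> linarith
      obtain ⟨z, hz, hz1, hz2⟩ := exists_grid_point hg hZ habs
      have h3 : η ≤ ∑ z ∈ Finset.Icc (-Z : ℤ) Z, (Fa (t - g * z) - Fb (t - g * z)) :=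
        (hη _ (by linarith) (by linarith)).trans
          (Finset.single_le_sum (f := fun z : ℤ => Fa (t - g * z) - Fb (t - g * z))
            (fun z _ => sub_nonneg.2 (hdom _)) hz)
      have h4 : 0 ≤ Fa (t - g) := cdfOf_payMass_nonneg hp i a _
      have h5 : Fb t ≤ 1 := cdfOf_payMass_le_one hp i b _
      have := mul_le_mul_of_nonneg_left h3 hk0
      linarith
  rw [Finset.sum_sub_distrib, mul_sub] at key
  rw [Finset.sum_sub_distrib] at hstates
  linarith

/-- If dominated actions are played, then there are noisy lotteries that are played although
they can be improved by moving an arbitrarily large share of their mass up by `g`. -/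
lemma exists_noise_game (hij : i ≠ j) (hS : IsSolutionConcept S) (hBr : Bracketing S)
    (hW : WeaklyMonotone S) (h : PlaysDominated S i) :
    ∃ g > 0, ∃ k Z : ℕ, ∀ q : ℕ, ∃ (C : Game N) (r : Profile C) (lo hi : C.A i), r ∈ S C ∧
      0 < r i lo ∧ ∃ ν > 0,
        (∀ φ, expPayOf C r i lo φ =
          ν * (k * ∑ z ∈ Finset.Icc (-Z : ℤ) Z, φ (g * z) + q * φ 0)) ∧
        (∀ φ, expPayOf C r i hi φ =
          ν * (k * ∑ z ∈ Finset.Icc (-Z : ℤ) Z, φ (g * z) + q * φ g)) := by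
  obtain ⟨G, p, a, b, hp, hdom, hpos⟩ := h
  have hpm := (hS _).2 _ hp
  obtain ⟨τ, hτ⟩ := exists_cdfOf_lt hdom
  obtain ⟨g, hg, hconst⟩ := exists_right_const G i τ
  obtain ⟨M, -, hM⟩ := exists_payoff_bound G i
  obtain ⟨k, hk⟩ := exists_nat_ge
    (1 / (cdfOf (payMass G p i a) τ - cdfOf (payMass G p i b) τ))
  obtain ⟨Z, hZ⟩ := exists_nat_ge ((M + g + |τ|) / g + 1)
  rw [div_le_iff₀ (sub_pos.2 hτ)] at hk
  have hk1 : Nonempty (Fin k) := by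
    rw [← Fin.pos_iff_nonempty]
    rcases k.eq_zero_or_pos with rfl | h0
    · norm_num at hk
    · exact h0
  have hZ1 : Nonempty (Finset.Icc (-Z : ℤ) Z) := ⟨⟨0, by simp⟩⟩
  refine ⟨g, hg, k, Z, fun q => ?_⟩
  obtain ⟨r, hr⟩ := (hS (duel i j (noisePay k Z q g) 0)).1
  have hrm := (hS _).2 _ hr
  obtain ⟨ν, hν, hE⟩ := hW.exists_expPayOf_duel_eq hij hS hr
  obtain ⟨⟨ℓ, y⟩, hℓ⟩ : ∃ x, 0 < r i x := IsDist.exists_pos ⟨(hrm i).1, (hrm i).2⟩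
  have hall : ∀ m : Fin (q + 1), 0 < r i (duelAction i m y) := by
    intro m
    induction m using Fin.reverseInduction with
    | last =>
      refine lt_of_lt_of_le hℓ (hW.row_le hij hS hr y fun c => ?_)
      rcases c with w | e
      · exact le_rfl
      · simp only [noisePay, if_pos e.castSucc_lt_last]
        split_ifs
        · exact le_rfl
        · exact hg.le
    | cast e ih =>
      have hle : p i a * r i (duelAction i e.succ y) ≤
          p i b * r i (duelAction i e.castSucc y) := by
        refine hW.mul_le hBr hp hr fun t => ?_
        rw [hE, hE]
        refine mul_le_mul_of_nonneg_left ?_ hν.le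
        refine sum_noisePay_cdf_le hpm hM hg hdom.1 (fun t h1 h2 => ?_) hk hZ e t
        rw [hconst p a t h1 h2, hconst p b t h1 h2]
      refine lt_of_le_of_ne ((hrm i).1 _) fun h0 => ?_
      rw [← h0, mul_zero] at hle
      exact absurd hle (not_le.2 (mul_pos hpos ih))
  refine ⟨_, r, duelAction i 0 y, duelAction i (Fin.last q) y, hr, hall 0, ν, hν,
    fun φ => ?_, fun φ => ?_⟩
  · rw [hE, sum_noisePay]
    simp
  · rw [hE, sum_noisePay]
    simp [Fin.castSucc_lt_last]

/-- Row payoffs of a game without acceptable solution. Columns other than `none` are noise, in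
which row `2` is worse than row `1` but equal to row `0`. -/
def pursuitPay (Z : ℕ) (g : ℝ) : Fin 3 → Option (Finset.Icc (-Z : ℤ) Z) → ℝ
  | 0, none => 0
  | 1, none => g / 2
  | 2, none => g
  | 0, some z => g * (z : ℤ)
  | 1, some z => g * (z : ℤ) + g / 2
  | 2, some z => g * (z : ℤ)

/-- Column payoffs: the noise columns are preferred exactly against row `2`. -/
def evasionPay (Z : ℕ) : Fin 3 → Option (Finset.Icc (-Z : ℤ) Z) → ℝ
  | 0, none => 1
  | 1, none => 1
  | 2, none => 0
  | 0, some _ => 0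
  | 1, some _ => 0
  | 2, some _ => 1

/-- Enough mass moved up by `g` in the noise game compensates for giving up `g` in the column
`none`. -/
lemma noise_compensates {g : ℝ} (hg : 0 < g) {k Z Z' q : ℕ} (hZ' : (g * Z + g) / g + 1 ≤ Z')
    {s w : ℝ} (hs0 : 0 ≤ s) (hs1 : s ≤ 1) (hw : 0 ≤ w)
    (hq : (k * (Finset.Icc (-Z : ℤ) Z).card : ℝ) ≤ w * q) (t : ℝ) {Fhi Flo : ℝ → ℝ}
    (hlo : ∀ t, Flo t = k * (∑ z ∈ Finset.Icc (-Z : ℤ) Z, if g * (z : ℝ) ≤ t then (1 : ℝ) else 0) +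
      q * (if 0 ≤ t then 1 else 0))
    (hhi : ∀ t, Fhi t = k * (∑ z ∈ Finset.Icc (-Z : ℤ) Z, if g * (z : ℝ) ≤ t then (1 : ℝ) else 0) +
      q * (if g ≤ t then 1 else 0)) :
    s * Fhi t + w * ∑ z ∈ Finset.Icc (-Z' : ℤ) Z', Fhi (t - g * z) ≤
      s * Flo (t - g) + w * ∑ z ∈ Finset.Icc (-Z' : ℤ) Z', Flo (t - g * z) := by
  set n : ℝ → ℝ := fun t => ∑ z ∈ Finset.Icc (-Z : ℤ) Z, if g * (z : ℝ) ≤ t then (1 : ℝ) else 0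
    with hn
  have hq0 : (0 : ℝ) ≤ q := q.cast_nonneg
  have hk0 : (0 : ℝ) ≤ k := k.cast_nonneg
  have hdiff : ∀ t, 0 ≤ Flo t - Fhi t := fun t => by
    rw [hlo, hhi]
    split_ifs <;> first | (exfalso; linarith) | linarith
  have hmove : Fhi t - Flo (t - g) = k * (n t - n (t - g)) := by
    rw [hlo, hhi, if_congr (sub_nonneg (a := t) (b := g)) rfl rfl]
    ring
  have hsum : 0 ≤ ∑ z ∈ Finset.Icc (-Z' : ℤ) Z', (Flo (t - g * z) - Fhi (t - g * z)) :=
    Finset.sum_nonneg fun z _ => hdiff _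
  have hn0 : ∀ t, 0 ≤ n t := fun t => Finset.sum_nonneg fun z _ => by split_ifs <;> norm_num
  have hn1 : ∀ t, n t ≤ (Finset.Icc (-Z : ℤ) Z).card := fun t => by
    rw [hn, Finset.card_eq_sum_ones, Nat.cast_sum]
    exact Finset.sum_le_sum fun z _ => by split_ifs <;> norm_num
  have key : s * (k * (n t - n (t - g))) ≤
      w * ∑ z ∈ Finset.Icc (-Z' : ℤ) Z', (Flo (t - g * z) - Fhi (t - g * z)) := by
    by_cases ht : |t| ≤ g * Z + g
    · obtain ⟨z, hz, hz1, hz2⟩ := exists_grid_point hg hZ' ht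
      have h1 : (q : ℝ) ≤ ∑ z ∈ Finset.Icc (-Z' : ℤ) Z', (Flo (t - g * z) - Fhi (t - g * z)) := by
        refine le_trans (le_of_eq ?_)
          (Finset.single_le_sum (f := fun z : ℤ => Flo (t - g * z) - Fhi (t - g * z))
            (fun z _ => hdiff _) hz)
        rw [hlo, hhi, if_pos hz1, if_neg (not_le.2 hz2)]
        ring
      have h2 : k * (n t - n (t - g)) ≤ k * (Finset.Icc (-Z : ℤ) Z).card :=
        mul_le_mul_of_nonneg_left (by linarith [hn1 t, hn0 (t - g)]) hk0
      have h3 : (0 : ℝ) ≤ k * (Finset.Icc (-Z : ℤ) Z).card := by positivity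
      calc s * (k * (n t - n (t - g))) ≤ s * (k * (Finset.Icc (-Z : ℤ) Z).card) :=
            mul_le_mul_of_nonneg_left h2 hs0
        _ ≤ 1 * (k * (Finset.Icc (-Z : ℤ) Z).card) := mul_le_mul_of_nonneg_right hs1 h3
        _ ≤ w * q := by linarith
        _ ≤ _ := mul_le_mul_of_nonneg_left h1 hw
    · have heq : n t = n (t - g) := by
        refine Finset.sum_congr rfl fun z hz => if_congr ?_ rfl rfl
        obtain ⟨h1, h2⟩ := Finset.mem_Icc.1 hz
        have h1' : (-Z : ℝ) ≤ z := by exact_mod_cast h1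
        have h2' : (z : ℝ) ≤ Z := by exact_mod_cast h2
        have h3 := mul_le_mul_of_nonneg_left h1' hg.le
        have h4 := mul_le_mul_of_nonneg_left h2' hg.le
        rcases lt_abs.1 (not_le.1 ht) with h | h
        · exact ⟨fun _ => by linarith, fun _ => by linarith⟩
        · exact ⟨fun _ => by linarith, fun _ => by linarith⟩
      rw [heq, sub_self, mul_zero, mul_zero]
      exact mul_nonneg hw hsum
  rw [← hmove, Finset.sum_sub_distrib] at key
  linarith

/-- Playing dominated actions entails playing actions dominated by a sure amount. -/
lemma exists_playsGapDominated (hij : i ≠ j) (hS : IsSolutionConcept S) (hBr : Bracketing S)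
    (hAn : Anonymity S) (hW : WeaklyMonotone S) (h : PlaysDominated S i) :
    ∃ L > 0, ∀ l, PlaysGapDominated S L l := by
  by_contra! hno
  have hA : ∀ L > 0, ∀ l, ¬ PlaysGapDominated S L l := fun L hL l hl => by
    obtain ⟨m, hm⟩ := hno L hL
    exact hm (hl.relabel hAn m)
  obtain ⟨g, hg, k, Z, hgame⟩ := exists_noise_game hij hS hBr hW h
  obtain ⟨Z', hZ'⟩ := exists_nat_ge ((g * Z + g) / g + 1)
  obtain ⟨p, hp⟩ := (hS (duel i j (pursuitPay Z' g) (evasionPay Z'))).1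
  have hpm := (hS _).2 _ hp
  have hrow := isDist_rowMarginal hpm
  have hcol := isDist_colMarginal hpm
  have hrow0 : rowMarginal p 0 = 0 := by
    refine rowMarginal_eq_zero hij hS hp (hA (g / 2) (by positivity) i) (x' := 1) fun c _ => ?_
    rcases c with _ | z <;> simp [pursuitPay]
  have z₀ : Finset.Icc (-Z' : ℤ) Z' := ⟨0, by simp⟩
  have hw : ∀ z, colMarginal p (some z) = colMarginal p (some z₀) := by
    have hle : ∀ z z', colMarginal p (some z) ≤ colMarginal p (some z') := fun z z' =>
      hW.colMarginal_le hij hS hp fun r => by fin_cases r <;> exact le_rfl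
    exact fun z => (hle _ _).antisymm (hle _ _)
  rcases (hcol.1 (some z₀)).eq_or_lt with hw0 | hw0
  · have hrow1 : rowMarginal p 1 = 0 := by
      refine rowMarginal_eq_zero hij hS hp (hA (g / 2) (by positivity) i) (x' := 2)
        fun c hc => ?_
      rcases c with _ | z
      · simp [pursuitPay]
      · rw [hw z, ← hw0] at hc
        exact absurd hc (lt_irrefl _)
    have hcol0 : colMarginal p none = 0 := by
      refine colMarginal_eq_zero hij hS hp (hA 1 one_pos j) (y' := some z₀) fun r hr => ?_
      fin_cases r
      · exact absurd hr (by simp [hrow0])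
      · exact absurd hr (by simp [hrow1])
      · simp [evasionPay]
    have hsum := hcol.2
    rw [Fintype.sum_option, hcol0, Finset.sum_eq_zero fun z _ => (hw z).trans hw0.symm] at hsum
    norm_num at hsum
  · have hrow2 : rowMarginal p 2 = 0 := by
      by_contra hne
      obtain ⟨y, -, hy⟩ := Finset.exists_ne_zero_of_sum_ne_zero hne
      obtain ⟨q, hq⟩ := exists_nat_ge
        ((k * (Finset.Icc (-Z : ℤ) Z).card : ℝ) / colMarginal p (some z₀))
      rw [div_le_iff₀ hw0, mul_comm (q : ℝ)] at hq
      obtain ⟨C, r, lo, hi, hr, hpos, ν, hν, hElo, hEhi⟩ := hgame q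
      have hle : r i lo * p i (duelAction i 2 y) ≤ r i hi * p i (duelAction i 0 y) := by
        refine hW.mul_le hBr hr hp fun t => ?_
        rw [expPayOf_duel_row hij hpm, expPayOf_duel_row hij hpm, Fintype.sum_option,
          Fintype.sum_option]
        simp only [hw, pursuitPay, sub_zero, ← Finset.mul_sum]
        have hs1 : colMarginal p none ≤ 1 := by
          rw [← hcol.2]
          exact Finset.single_le_sum (fun c _ => hcol.1 c) (Finset.mem_univ none)
        rw [Finset.sum_coe_sort (Finset.Icc (-Z' : ℤ) Z')
            fun z => cdfOf (payMass C r i hi) (t - g * z),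
          Finset.sum_coe_sort (Finset.Icc (-Z' : ℤ) Z')
            fun z => cdfOf (payMass C r i lo) (t - g * z)]
        have hcmp := mul_le_mul_of_nonneg_left
          (noise_compensates hg hZ' (hcol.1 none) hs1 hw0.le hq t (fun _ => rfl) fun _ => rfl) hν.le
        simp only [cdfOf_payMass, hElo, hEhi, ← Finset.mul_sum]
        linarith
      have hrow0y : p i (duelAction i 0 y) = 0 :=
        (Finset.sum_eq_zero_iff_of_nonneg fun y _ => (hpm i).1 _).1 hrow0 y (Finset.mem_univ y)
      rw [hrow0y, mul_zero] at hle
      exact absurd hle (not_le.2 (mul_pos hpos (lt_of_le_of_ne ((hpm i).1 _) hy.symm)))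
    refine hw0.ne' (colMarginal_eq_zero hij hS hp (hA 1 one_pos j) (y' := none) fun r hr => ?_)
    fin_cases r
    · simp [evasionPay]
    · simp [evasionPay]
    · exact absurd hr (by simp [hrow2])

end Noise

/-- under bracketing, distribution-monotonicity and anonymity, exactly one
of the following holds: `S` refines FOSD-Nash, or `S` refines FOSD-QRE. -/
theorem stmt6 {N : ℕ} (hN : 2 ≤ N) (S : SolCon N) (hS : IsSolutionConcept S)
    (hBr : Bracketing S) (hDM : DistributionMonotone S) (hAn : Anonymity S) :
    Xor' (∀ G, ∀ p ∈ S G, IsFOSDNash G p) (∀ G, ∀ p ∈ S G, IsFOSDQRE G p) := by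
  have hij : (⟨0, by omega⟩ : Fin N) ≠ ⟨1, by omega⟩ := by simp
  by_cases h1 : ∀ G, ∀ p ∈ S G, IsFOSDNash G p
  · exact Or.inl ⟨h1, fun h2 => not_isFOSDNash_and_isFOSDQRE hij hS h1 h2⟩
  · refine Or.inr ⟨?_, h1⟩
    push Not at h1
    obtain ⟨G, p, hp, hnash⟩ := h1
    simp only [IsFOSDNash, not_forall] at hnash
    obtain ⟨i, a, ⟨b, hb⟩, hne⟩ := hnash
    have hdom : PlaysDominated S i :=
      ⟨G, p, a, b, hp, hb, lt_of_le_of_ne (((hS _).2 _ hp i).1 a) (Ne.symm hne)⟩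
    have hW := weaklyMonotone_of_playsDominated hS hBr hDM fun j => hdom.relabel hAn j
    obtain ⟨L, hL, hgap⟩ := exists_playsGapDominated hij hS hBr hAn hW (hdom.relabel hAn _)
    exact fun H q hq => hW.isFOSDQRE hS hBr hL hgap hq

end Paper
end
end
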